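/- arXiv:1903.08021 — 3 statements merged into one kernel-verified Lean document; each statement's English description precedes it below -/
import Mathlib

section
/- Let μ be the uniform probability measure on {-1,1}^n and let ν = e^f dμ be a probability measure on {-1,1}^n. For x ∈ {-1,1}^n let ∇f(x) = (∂_1 f(x),…,∂_n f(x)) denote the discrete gradient, ∂_i f(x) = (f(x_+) - f(x_-))/2 where x_± agree with x except that the i-th coordinate is ±1. Define I₁(s) = ((1+s)/2)·log(1+s) + ((1-s)/2)·log(1-s) for s ∈ [-1,1], and ℐ(ν) = ∫ Σ_{i=1}^n I₁( tanh(∂_i f(x)) ) dν(x). Then there exists a universal constant κ > 0 such that ℐ(ν) ≤ H(ν|μ) + κ · ∫ sup_{y ∈ {-1,1}^n} ⟨∇f(y), x⟩ dμ(x). -/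
open MeasureTheory Real Set ENNReal
open scoped Classical

/-- The transportation cost `W_c(ν, μ)`: infimum of `∫ c dπ` over all couplings `π`
of `ν` and `μ`. -/
noncomputable def transportCost {E F : Type*} [MeasurableSpace E] [MeasurableSpace F]
    (c : E → F → ℝ≥0∞) (ν : Measure E) (μ : Measure F) : ℝ≥0∞ :=
  ⨅ (P : Measure (E × F)) (_ : P.map Prod.fst = ν) (_ : P.map Prod.snd = μ),
    ∫⁻ p, c p.1 p.2 ∂P

/-- The relative entropy `H(ν|μ) = ∫ log (dν/dμ) dν` if `ν ≪ μ` (and the integral is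
well defined), and `+∞` otherwise.  (Since the negative part of `log (dν/dμ)` is always
`ν`-integrable for probability measures, non-integrability corresponds to `H = +∞`.) -/

noncomputable def relEntropy {E : Type*} [MeasurableSpace E] (ν μ : Measure E) : ℝ≥0∞ :=
  if ν ≪ μ ∧ Integrable (fun x => Real.log ((ν.rnDeriv μ x).toReal)) ν
  then ENNReal.ofReal (∫ x, Real.log ((ν.rnDeriv μ x).toReal) ∂ν) else ⊤

/-- The uniform probability measure on the discrete hypercube `{-1,1}ⁿ`,
viewed as a measure on `ℝⁿ`. -/
noncomputable def cubeUniform (n : ℕ) : Measure (Fin n → ℝ) :=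
  Measure.pi fun _ =>
    ((2 : ℝ≥0∞)⁻¹ • Measure.dirac (-1 : ℝ) + (2 : ℝ≥0∞)⁻¹ • Measure.dirac (1 : ℝ))

/-- The vertices `{-1,1}ⁿ` of the hypercube. -/
def cubeVertices (n : ℕ) : Set (Fin n → ℝ) := {y | ∀ i, y i = -1 ∨ y i = 1}

/-- The discrete partial derivative `∂ᵢ f(x) = (f(x₊) - f(x₋))/2`, where `x_±` agree with
`x` except that the `i`-th coordinate is `±1`. -/
noncomputable def dpartial (n : ℕ) (f : (Fin n → ℝ) → ℝ) (i : Fin n) (x : Fin n → ℝ) : ℝ :=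
  (f (Function.update x i 1) - f (Function.update x i (-1))) / 2

/-- `I₁(s) = ((1+s)/2) log (1+s) + ((1-s)/2) log (1-s)`. -/
noncomputable def I1 (s : ℝ) : ℝ :=
  (1 + s) / 2 * Real.log (1 + s) + (1 - s) / 2 * Real.log (1 - s)

/-- The sign vector in `{-1,1}ⁿ` attached to a Boolean vector. -/
noncomputable def signVec {n : ℕ} (σ : Fin n → Bool) : Fin n → ℝ := fun i => if σ i then 1 else -1

/-- The average of a function over the Boolean cube. -/
noncomputable def cubeAvg (n : ℕ) (g : (Fin n → Bool) → ℝ) : ℝ := (2 ^ n : ℝ)⁻¹ * ∑ σ, g σ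

theorem cubeAvg_mono {n : ℕ} {g h : (Fin n → Bool) → ℝ} (H : ∀ σ, g σ ≤ h σ) :
    cubeAvg n g ≤ cubeAvg n h :=
  mul_le_mul_of_nonneg_left (Finset.sum_le_sum fun σ _ => H σ) (by positivity)

theorem cubeAvg_const (n : ℕ) (c : ℝ) : cubeAvg n (fun _ => c) = c := by
  simp [cubeAvg]

theorem cubeAvg_add {n : ℕ} (g h : (Fin n → Bool) → ℝ) :
    cubeAvg n (fun σ => g σ + h σ) = cubeAvg n g + cubeAvg n h := by
  simp [cubeAvg, Finset.sum_add_distrib, mul_add]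

theorem cubeAvg_sub {n : ℕ} (g h : (Fin n → Bool) → ℝ) :
    cubeAvg n (fun σ => g σ - h σ) = cubeAvg n g - cubeAvg n h := by
  simp [cubeAvg, Finset.sum_sub_distrib, mul_sub]

theorem cubeAvg_const_mul {n : ℕ} (c : ℝ) (g : (Fin n → Bool) → ℝ) :
    cubeAvg n (fun σ => c * g σ) = c * cubeAvg n g := by
  simp [cubeAvg, ← Finset.mul_sum, mul_left_comm]

theorem cubeAvg_sum {n : ℕ} {ι : Type*} (s : Finset ι) (g : ι → (Fin n → Bool) → ℝ) :
    cubeAvg n (fun σ => ∑ i ∈ s, g i σ) = ∑ i ∈ s, cubeAvg n (g i) := by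
  simp only [cubeAvg]
  rw [Finset.sum_comm, Finset.mul_sum]

theorem cubeAvg_div_const {n : ℕ} (g : (Fin n → Bool) → ℝ) (c : ℝ) :
    cubeAvg n (fun σ => g σ / c) = cubeAvg n g / c := by
  simp [cubeAvg, ← Finset.sum_div, mul_div_assoc]

theorem cubeAvg_succ {n : ℕ} (g : (Fin (n + 1) → Bool) → ℝ) :
    cubeAvg (n + 1) g =
      (cubeAvg n (fun σ => g (Fin.cons true σ)) + cubeAvg n (fun σ => g (Fin.cons false σ))) / 2 := by
  have h : ∑ σ, g σ = ∑ p : Bool × (Fin n → Bool), g (Fin.cons p.1 p.2) :=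
    (Fintype.sum_equiv (Fin.consEquiv fun _ => Bool) _ _ fun _ => rfl).symm
  rw [cubeAvg, h, Fintype.sum_prod_type, Fintype.sum_bool, cubeAvg, cubeAvg, pow_succ]
  field_simp

/-- Jensen's inequality for the exponential, with weights of average one. -/
theorem exp_cubeAvg_mul_le {n : ℕ} {w : (Fin n → Bool) → ℝ} (hw : ∀ σ, 0 ≤ w σ)
    (hw1 : cubeAvg n w = 1) (g : (Fin n → Bool) → ℝ) :
    exp (cubeAvg n fun σ => w σ * g σ) ≤ cubeAvg n fun σ => w σ * exp (g σ) := by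
  have h := convexOn_exp.map_sum_le (t := Finset.univ) (w := fun σ => (2 ^ n : ℝ)⁻¹ * w σ) (p := g)
    (fun σ _ => mul_nonneg (by positivity) (hw σ))
    (by rw [← Finset.mul_sum]; exact hw1) (fun _ _ => Set.mem_univ _)
  simpa [cubeAvg, Finset.mul_sum, mul_assoc] using h

theorem exp_cubeAvg_le {n : ℕ} (g : (Fin n → Bool) → ℝ) :
    exp (cubeAvg n g) ≤ cubeAvg n fun σ => exp (g σ) := by
  simpa using exp_cubeAvg_mul_le (fun _ => zero_le_one) (cubeAvg_const n 1) g

theorem exp_cubeAvg_midpoint_le {n : ℕ} {u v T : (Fin n → Bool) → ℝ}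
    (H : ∀ σ, (exp (u σ) + exp (v σ)) / 2 ≤ exp (T σ)) :
    (exp (cubeAvg n u) + exp (cubeAvg n v)) / 2 ≤ exp (cubeAvg n T) := by
  have hu := exp_cubeAvg_le fun σ => u σ - T σ
  have hv := exp_cubeAvg_le fun σ => v σ - T σ
  have h : cubeAvg n (fun σ => (exp (u σ - T σ) + exp (v σ - T σ)) / 2) ≤ 1 := by
    rw [← cubeAvg_const n 1]
    refine cubeAvg_mono fun σ => ?_
    rw [exp_sub, exp_sub, ← add_div, div_right_comm, div_le_one (exp_pos _)]
    exact H σ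
  rw [cubeAvg_div_const, cubeAvg_add] at h
  rw [cubeAvg_sub, exp_sub] at hu hv
  have hsum : exp (cubeAvg n u) / exp (cubeAvg n T) + exp (cubeAvg n v) / exp (cubeAvg n T) ≤ 2 := by
    linarith
  rw [← add_div, div_le_iff₀ (exp_pos _)] at hsum
  linarith

theorem exp_add_sub_log_cosh (a b : ℝ) :
    exp (a + (b - log (cosh b))) = 2 * exp a / (1 + exp (-(2 * b))) := by
  rw [exp_add, exp_sub, exp_log (cosh_pos b), cosh_eq]
  have h : exp (-(2 * b)) = exp (-b) / exp b := by rw [← exp_sub]; congr 1; ring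
  rw [h]
  field_simp

/-- The two-point inequality behind the bound for suprema of Rademacher processes. -/
theorem two_point_exp_le {a b a' b' R : ℝ} (h : a ≤ R) (h' : a' ≤ R)
    (hR : a + a' + 2 * (b - b') ≤ 2 * R) :
    (exp (a + (b - log (cosh b))) + exp (a' + (-b' - log (cosh b')))) / 2 ≤ exp R := by
  rw [← cosh_neg b', exp_add_sub_log_cosh, exp_add_sub_log_cosh]
  have hp : exp (a - R) ≤ 1 := exp_le_one_iff.2 (by linarith)
  have hq : exp (a' - R) ≤ 1 := exp_le_one_iff.2 (by linarith)
  have hpq : exp (a - R) * exp (a' - R) ≤ exp (-(2 * b)) * exp (-(2 * -b')) := by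
    rw [← exp_add, ← exp_add]
    exact exp_le_exp.2 (by linarith)
  have ha : exp a = exp (a - R) * exp R := by rw [← exp_add]; congr 1; ring
  have ha' : exp a' = exp (a' - R) * exp R := by rw [← exp_add]; congr 1; ring
  rw [ha, ha']
  have hu := exp_pos (-(2 * b))
  have hv := exp_pos (-(2 * -b'))
  generalize exp (-(2 * b)) = u at *
  generalize exp (-(2 * -b')) = v at *
  generalize exp (a - R) = p at *
  generalize exp (a' - R) = q at *
  have key : p / (1 + u) + q / (1 + v) ≤ 1 := by
    rw [div_add_div _ _ (by positivity) (by positivity), div_le_one (by positivity)]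
    nlinarith [mul_nonneg (sub_nonneg.2 hp) (sub_nonneg.2 hq), mul_nonneg (sub_nonneg.2 hp) hv.le,
      mul_nonneg (sub_nonneg.2 hq) hu.le]
  calc (2 * (p * exp R) / (1 + u) + 2 * (q * exp R) / (1 + v)) / 2
      = (p / (1 + u) + q / (1 + v)) * exp R := by ring
    _ ≤ 1 * exp R := mul_le_mul_of_nonneg_right key (exp_pos R).le
    _ = exp R := one_mul _

theorem two_point_exp_iSup_le {ι : Type*} [Finite ι] [Nonempty ι] (a b : ι → ℝ) :
    (exp (⨆ t, (a t + (b t - log (cosh (b t))))) +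
        exp (⨆ t, (a t + (-b t - log (cosh (b t)))))) / 2 ≤
      exp (((⨆ t, (a t + 2 * b t)) + ⨆ t, (a t - 2 * b t)) / 2) := by
  obtain ⟨s, hs⟩ := exists_eq_ciSup_of_finite (f := fun t => a t + (b t - log (cosh (b t))))
  obtain ⟨t, ht⟩ := exists_eq_ciSup_of_finite (f := fun t => a t + (-b t - log (cosh (b t))))
  rw [← hs, ← ht]
  have hp := fun t => le_ciSup (Set.finite_range fun t => a t + 2 * b t).bddAbove t
  have hm := fun t => le_ciSup (Set.finite_range fun t => a t - 2 * b t).bddAbove t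
  apply two_point_exp_le
  · linarith [hp s, hm s]
  · linarith [hp t, hm t]
  · linarith [hp s, hm t]

theorem signVec_cons_zero {n : ℕ} (b : Bool) (σ : Fin n → Bool) :
    signVec (Fin.cons b σ : Fin (n + 1) → Bool) 0 = if b then 1 else -1 := rfl

theorem signVec_cons_succ {n : ℕ} (b : Bool) (σ : Fin n → Bool) (i : Fin n) :
    signVec (Fin.cons b σ : Fin (n + 1) → Bool) i.succ = signVec σ i := rfl

/-- Exponential moments of the supremum of a compensated Rademacher process are controlled by the
expected supremum. -/
theorem cubeAvg_exp_iSup_le {ι : Type*} [Finite ι] [Nonempty ι] (n : ℕ) (c : ι → ℝ)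
    (b : ι → Fin n → ℝ) :
    cubeAvg n (fun σ => exp (⨆ t, (c t + ∑ i, (b t i * signVec σ i - log (cosh (b t i)))))) ≤
      exp (cubeAvg n fun σ => ⨆ t, (c t + 2 * ∑ i, b t i * signVec σ i)) := by
  induction n generalizing c with
  | zero => simp [cubeAvg]
  | succ n ih =>
    rw [cubeAvg_succ, cubeAvg_succ (fun σ => ⨆ _, _), ← cubeAvg_add (fun σ => ⨆ _, _),
      ← cubeAvg_div_const]
    have hmid := exp_cubeAvg_midpoint_le fun σ : Fin n → Bool =>
      two_point_exp_iSup_le (fun t => c t + 2 * ∑ i, b t (Fin.succ i) * signVec σ i)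
        fun t => b t 0
    have hT := ih (fun t => c t + (b t 0 - log (cosh (b t 0)))) fun t i => b t i.succ
    have hF := ih (fun t => c t + (-b t 0 - log (cosh (b t 0)))) fun t i => b t i.succ
    simp only [add_right_comm (c _) _ (2 * _)] at hT hF
    refine (div_le_div_of_nonneg_right (add_le_add ?_ ?_) two_pos.le).trans (hmid.trans_eq ?_)
    · refine (le_of_eq ?_).trans hT
      congr! 5
      rw [Fin.sum_univ_succ]
      simp only [signVec_cons_zero, signVec_cons_succ, if_true, mul_one, add_assoc]
    · refine (le_of_eq ?_).trans hF
      congr! 5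
      rw [Fin.sum_univ_succ]
      simp only [signVec_cons_zero, signVec_cons_succ, Bool.false_eq_true, if_false, mul_neg,
        mul_one, add_assoc]
    · congr! 6
      all_goals
        ext t
        rw [Fin.sum_univ_succ]
        simp only [signVec_cons_zero, signVec_cons_succ, if_true, Bool.false_eq_true, if_false]
        ring

theorem I1_tanh (d : ℝ) : I1 (tanh d) = d * tanh d - log (cosh d) := by
  have hc := cosh_pos d
  have hp : 1 + tanh d = exp d / cosh d := by
    rw [tanh_eq_sinh_div_cosh, ← cosh_add_sinh]; field_simp
  have hm : 1 - tanh d = exp (-d) / cosh d := by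
    rw [tanh_eq_sinh_div_cosh, ← cosh_sub_sinh]; field_simp
  have hlp : Real.log (1 + tanh d) = d - log (cosh d) := by
    rw [hp, log_div (exp_ne_zero _) hc.ne', log_exp]
  have hlm : Real.log (1 - tanh d) = -d - log (cosh d) := by
    rw [hm, log_div (exp_ne_zero _) hc.ne', log_exp]
  rw [I1, hlp, hlm]
  ring

/-- Discrete integration by parts: conditionally on the other coordinates, the mean of the `i`-th
coordinate under `e^f dμ` is `tanh (∂ᵢ f)`. -/
theorem cubeAvg_exp_mul_tanh {n : ℕ} (f : (Fin n → ℝ) → ℝ) (i : Fin n) :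
    cubeAvg n (fun σ => exp (f (signVec σ)) *
        (dpartial n f i (signVec σ) * tanh (dpartial n f i (signVec σ)))) =
      cubeAvg n fun σ => exp (f (signVec σ)) * (dpartial n f i (signVec σ) * signVec σ i) := by
  rw [← sub_eq_zero, ← cubeAvg_sub, cubeAvg, mul_eq_zero]
  right
  have hinv : Function.Involutive fun σ : Fin n → Bool => Function.update σ i (!σ i) :=
    fun σ => by simp
  have hsign (σ : Fin n → Bool) (b : Bool) : signVec (Function.update σ i b) =
      Function.update (signVec σ) i (if b then 1 else -1) := by
    ext j
    by_cases h : j = i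
    · subst h; simp [signVec]
    · simp [signVec, h]
  have hsum := Equiv.sum_comp hinv.toPerm fun σ =>
    exp (f (signVec σ)) * (dpartial n f i (signVec σ) * tanh (dpartial n f i (signVec σ))) -
      exp (f (signVec σ)) * (dpartial n f i (signVec σ) * signVec σ i)
  have hzero (p q : ℝ) :
      exp p * (tanh ((p - q) / 2) - 1) + exp q * (tanh ((p - q) / 2) + 1) = 0 := by
    have hc := cosh_pos ((p - q) / 2)
    have hp : exp p = exp ((p + q) / 2) * exp ((p - q) / 2) := by rw [← exp_add]; congr 1; ring
    have hq : exp q = exp ((p + q) / 2) * exp (-((p - q) / 2)) := by rw [← exp_add]; congr 1; ring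
    rw [hp, hq, tanh_eq_sinh_div_cosh, ← cosh_add_sinh ((p - q) / 2),
      ← cosh_sub_sinh ((p - q) / 2)]
    generalize cosh ((p - q) / 2) = C at *
    field_simp
    ring
  rw [← add_self_eq_zero]
  nth_rewrite 1 [← hsum]
  rw [← Finset.sum_add_distrib]
  refine Finset.sum_eq_zero fun σ _ => ?_
  have hz := hzero (f (Function.update (signVec σ) i 1)) (f (Function.update (signVec σ) i (-1)))
  have hself : Function.update (signVec σ) i (if σ i then 1 else -1) = signVec σ := by
    rw [← hsign, Function.update_eq_self]
  simp only [Function.Involutive.coe_toPerm, hsign, dpartial, Function.update_idem,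
    Function.update_self]
  cases hσ : σ i
  · simp only [hσ, Bool.false_eq_true, if_false] at hself
    have hi : signVec σ i = -1 := by simp [signVec, hσ]
    rw [hi, ← hself]
    simp only [Bool.not_false, if_true, Function.update_idem]
    linear_combination ((f (Function.update (signVec σ) i 1) -
      f (Function.update (signVec σ) i (-1))) / 2) * hz
  · simp only [hσ, if_true] at hself
    have hi : signVec σ i = 1 := by simp [signVec, hσ]
    rw [hi, ← hself]
    simp only [Bool.not_true, Bool.false_eq_true, if_false, Function.update_idem]
    linear_combination ((f (Function.update (signVec σ) i 1) -
      f (Function.update (signVec σ) i (-1))) / 2) * hz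

theorem finite_cubeVertices (n : ℕ) : Finite (cubeVertices n) := by
  refine (Set.Finite.subset (Set.Finite.pi' (t := fun _ : Fin n => ({-1, 1} : Set ℝ))
    fun _ => by simp) fun y hy i => ?_)
  simpa using hy i

theorem signVec_mem_cubeVertices {n : ℕ} (σ : Fin n → Bool) : signVec σ ∈ cubeVertices n :=
  fun i => by by_cases h : σ i <;> simp [signVec, h]

theorem cubeUniform_eq_sum_dirac (n : ℕ) :
    cubeUniform n = ∑ σ : Fin n → Bool, ((2 : ℝ≥0∞)⁻¹ ^ n) • Measure.dirac (signVec σ) := by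
  have : IsFiniteMeasure ((2 : ℝ≥0∞)⁻¹ • Measure.dirac (-1 : ℝ) +
      (2 : ℝ≥0∞)⁻¹ • Measure.dirac (1 : ℝ)) := ⟨by simp⟩
  refine Measure.pi_eq (μ := fun _ : Fin n => (2 : ℝ≥0∞)⁻¹ • Measure.dirac (-1 : ℝ) +
    (2 : ℝ≥0∞)⁻¹ • Measure.dirac (1 : ℝ)) fun s hs => ?_
  have hm := MeasurableSet.univ_pi hs
  simp only [Measure.coe_finsetSum, Finset.sum_apply, Measure.smul_apply, Measure.add_apply,
    Measure.coe_smul, Pi.smul_apply,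
    Measure.dirac_apply' _ hm, Measure.dirac_apply' _ (hs _), smul_eq_mul]
  have h : ∀ i : Fin n, (2 : ℝ≥0∞)⁻¹ * (s i).indicator 1 (-1) + 2⁻¹ * (s i).indicator 1 1 =
      ∑ b : Bool, 2⁻¹ * (s i).indicator 1 (if b then (1 : ℝ) else -1) := by
    intro i; simp [add_comm]
  simp only [h]
  rw [Finset.prod_univ_sum]
  simp only [Fintype.piFinset_univ, Finset.prod_mul_distrib, Finset.prod_const, Finset.card_univ,
    Fintype.card_fin]
  refine Finset.sum_congr rfl fun σ _ => ?_
  congr 1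
  simp only [Set.indicator_apply, Pi.one_apply, Finset.prod_boole, Set.mem_univ_pi, signVec,
    Finset.mem_univ, true_imp_iff]

theorem aemeasurable_cubeUniform {n : ℕ} {β : Type*} [MeasurableSpace β] [Nonempty β]
    (g : (Fin n → ℝ) → β) : AEMeasurable g (cubeUniform n) := by
  rw [cubeUniform_eq_sum_dirac, ← Measure.sum_fintype, aemeasurable_sum_measure_iff]
  exact fun σ => aemeasurable_dirac.smul_measure _

theorem integrable_cubeUniform {n : ℕ} (g : (Fin n → ℝ) → ℝ) : Integrable g (cubeUniform n) := by
  rw [cubeUniform_eq_sum_dirac, integrable_finsetSum_measure]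
  exact fun σ _ => (integrable_dirac (by simp)).smul_measure (by simp)

theorem integral_cubeUniform {n : ℕ} (g : (Fin n → ℝ) → ℝ) :
    ∫ x, g x ∂cubeUniform n = cubeAvg n fun σ => g (signVec σ) := by
  rw [cubeUniform_eq_sum_dirac, integral_finsetSum_measure
    fun σ _ => (integrable_dirac (by simp)).smul_measure (by simp)]
  simp [cubeAvg, Finset.mul_sum]

theorem integral_withDensity_exp_cubeUniform {n : ℕ} (f g : (Fin n → ℝ) → ℝ) :
    ∫ x, g x ∂(cubeUniform n).withDensity (fun x => ENNReal.ofReal (exp (f x))) =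
      cubeAvg n fun σ => exp (f (signVec σ)) * g (signVec σ) := by
  rw [integral_withDensity_eq_integral_toReal_smul₀ (aemeasurable_cubeUniform _) (by simp),
    integral_cubeUniform]
  simp [ENNReal.toReal_ofReal (exp_pos _).le]

theorem integral_le_relEntropy_withDensity_exp {n : ℕ} (f : (Fin n → ℝ) → ℝ) :
    cubeAvg n (fun σ => exp (f (signVec σ)) * f (signVec σ)) ≤
      (relEntropy ((cubeUniform n).withDensity fun x => ENNReal.ofReal (exp (f x)))
        (cubeUniform n)).toReal := by
  have : IsFiniteMeasure (cubeUniform n) := by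
    rw [cubeUniform_eq_sum_dirac]
    refine ⟨?_⟩
    simp [ENNReal.mul_lt_top]
  set ν := (cubeUniform n).withDensity fun x => ENNReal.ofReal (exp (f x)) with hν
  have hac : ν ≪ cubeUniform n := withDensity_absolutelyContinuous _ _
  have hlog : (fun x => Real.log ((ν.rnDeriv (cubeUniform n) x).toReal)) =ᵐ[ν] f := by
    filter_upwards [hac.ae_le (Measure.rnDeriv_withDensity₀ _
      (aemeasurable_cubeUniform fun x => ENNReal.ofReal (exp (f x))))] with x hx
    rw [hx, ENNReal.toReal_ofReal (exp_pos _).le, log_exp]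
  have hint : Integrable f ν := by
    rw [hν, integrable_withDensity_iff_integrable_smul₀' (aemeasurable_cubeUniform _) (by simp)]
    exact integrable_cubeUniform _
  rw [relEntropy, if_pos ⟨hac, hint.congr hlog.symm⟩, integral_congr_ae hlog, hν,
    integral_withDensity_exp_cubeUniform, ENNReal.toReal_ofReal']
  exact le_max_left _ _

/-- The Gibbs variational principle on the cube. -/
theorem cubeAvg_exp_mul_le {n : ℕ} {g h : (Fin n → Bool) → ℝ} {B : ℝ}
    (hg : cubeAvg n (fun σ => exp (g σ)) = 1) (hh : cubeAvg n (fun σ => exp (h σ)) ≤ exp B) :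
    cubeAvg n (fun σ => exp (g σ) * h σ) ≤ cubeAvg n (fun σ => exp (g σ) * g σ) + B := by
  have hJ := exp_cubeAvg_mul_le (fun σ => (exp_pos (g σ)).le) hg fun σ => h σ - g σ
  simp only [← exp_add, add_sub_cancel, mul_sub, cubeAvg_sub] at hJ
  linarith [exp_le_exp.1 (hJ.trans hh)]

/-- **Reverse log-Sobolev inequality on the discrete hypercube.** There is a universal
constant `κ > 0` such that for every probability measure `ν = e^f dμ` on `{-1,1}ⁿ`,
`ℐ(ν) ≤ H(ν|μ) + κ ∫ sup_{y ∈ {-1,1}ⁿ} ⟨∇f(y), x⟩ dμ(x)`, where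
`ℐ(ν) = ∫ ∑ i, I₁(tanh (∂ᵢ f)) dν` and `∇f` is the discrete gradient. -/
theorem reverse_logSobolev_cube :
    ∃ κ : ℝ, 0 < κ ∧ ∀ (n : ℕ) (f : (Fin n → ℝ) → ℝ) (ν : Measure (Fin n → ℝ)),
      ν = (cubeUniform n).withDensity (fun x => ENNReal.ofReal (Real.exp (f x))) →
      IsProbabilityMeasure ν →
      ∫ x, ∑ i, I1 (Real.tanh (dpartial n f i x)) ∂ν ≤
        (relEntropy ν (cubeUniform n)).toReal +
          κ * ∫ x, (⨆ y : cubeVertices n, ∑ i, dpartial n f i y * x i) ∂cubeUniform n := by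
  refine ⟨2, two_pos, fun n f ν hν hprob => ?_⟩
  have hfin := finite_cubeVertices n
  have hne : Nonempty (cubeVertices n) := ⟨⟨_, signVec_mem_cubeVertices fun _ => true⟩⟩
  have hmass : cubeAvg n (fun σ => exp (f (signVec σ))) = 1 := by
    have h : ∫ _, (1 : ℝ) ∂ν = 1 := by simp
    rw [hν, integral_withDensity_exp_cubeUniform] at h
    simpa using h
  set d := fun (y : Fin n → ℝ) i => dpartial n f i y with hd
  have hparts : ∫ x, ∑ i, I1 (Real.tanh (dpartial n f i x)) ∂ν =
      cubeAvg n fun σ => exp (f (signVec σ)) *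
        ∑ i, (d (signVec σ) i * signVec σ i - log (cosh (d (signVec σ) i))) := by
    rw [hν, integral_withDensity_exp_cubeUniform]
    simp only [Finset.mul_sum, I1_tanh, cubeAvg_sum, mul_sub, cubeAvg_sub, hd,
      cubeAvg_exp_mul_tanh]
  have hsup := cubeAvg_exp_iSup_le n (fun _ => 0) fun y : cubeVertices n => d y
  simp only [zero_add, ← Real.mul_iSup_of_nonneg zero_le_two, cubeAvg_const_mul] at hsup
  refine hparts.trans_le (le_trans (cubeAvg_mono fun σ => mul_le_mul_of_nonneg_left
    (le_ciSup (Set.finite_range fun y : cubeVertices n =>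
      ∑ i, (d y i * signVec σ i - log (cosh (d y i)))).bddAbove
        ⟨signVec σ, signVec_mem_cubeVertices σ⟩) (exp_pos _).le) ?_)
  refine (cubeAvg_exp_mul_le hmass hsup).trans ?_
  rw [integral_cubeUniform, hν]
  gcongr
  exact integral_le_relEntropy_withDensity_exp f
end

section
/- For i ∈ {1,2}, let μ_i, μ̃_i be probability measures on ℝ^{d_i} and c_i : ℝ^{d_i} × ℝ^{d_i} → [0,+∞] lower semi-continuous functions such that for every probability measure ν on ℝ^{d_i}, W_{c_i}(ν, μ̃_i) ≤ H(ν | μ_i). Then for every probability measure ν on ℝ^{d_1} × ℝ^{d_2}, W_{c_1⊕c_2}(ν, μ̃_1 ⊗ μ̃_2) ≤ H(ν | μ_1 ⊗ μ_2), where (c_1 ⊕ c_2)((x_1,x_2),(y_1,y_2)) = c_1(x_1,y_1) + c_2(x_2,y_2). -/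
open MeasureTheory Real Set ENNReal
open scoped Classical

namespace TransportEntropy

open Filter Topology ProbabilityTheory InformationTheory

/-- The relative entropy agrees with the Kullback-Leibler divergence on probability measures. -/
lemma relEntropy_eq_klDiv {E : Type*} [MeasurableSpace E] (ν μ : Measure E)
    [IsProbabilityMeasure ν] [IsProbabilityMeasure μ] : relEntropy ν μ = klDiv ν μ := by
  rw [relEntropy, klDiv_def]
  simp [llr_def]

/-- If the transportation cost between probability measures is at most `a`, then some coupling
has cost at most `a + ε`. -/
lemma exists_coupling_le {E F : Type*} [MeasurableSpace E] [MeasurableSpace F]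
    {c : E → F → ℝ≥0∞} {ν : Measure E} {μ : Measure F}
    [IsProbabilityMeasure ν] [IsProbabilityMeasure μ] {a ε : ℝ≥0∞}
    (h : transportCost c ν μ ≤ a) (hε : ε ≠ 0) :
    ∃ P : Measure (E × F), P.fst = ν ∧ P.snd = μ ∧ ∫⁻ p, c p.1 p.2 ∂P ≤ a + ε := by
  by_cases ha : a = ⊤
  · exact ⟨ν.prod μ, by simp, by simp, by simp [ha]⟩
  have hlt : transportCost c ν μ < a + ε := h.trans_lt (ENNReal.lt_add_right ha hε)
  simp only [transportCost, iInf_lt_iff] at hlt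
  obtain ⟨P, h1, h2, h3⟩ := hlt
  exact ⟨P, h1, h2, h3.le⟩

/-- The averaged divergence of two kernels is bounded by the divergence of the
composition-products. -/
lemma lintegral_klDiv_le_klDiv_compProd {α β : Type*} [MeasurableSpace α] [MeasurableSpace β]
    [MeasurableSpace.CountableOrCountablyGenerated α β] (μ : Measure α) [IsFiniteMeasure μ]
    (κ η : Kernel α β) [IsMarkovKernel κ] [IsMarkovKernel η] :
    ∫⁻ a, klDiv (κ a) (η a) ∂μ ≤ klDiv (μ ⊗ₘ κ) (μ ⊗ₘ η) := by
  by_cases hac : μ ⊗ₘ κ ≪ μ ⊗ₘ η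
  swap; · simp [hac]
  have hac' : ∀ᵐ a ∂μ, κ a ≪ η a := hac.kernel_of_compProd
  have hmeas : Measurable (Function.uncurry (κ.rnDeriv η)) := Kernel.measurable_rnDeriv κ η
  have hwd : μ ⊗ₘ κ = (μ ⊗ₘ η).withDensity (fun p ↦ κ.rnDeriv η p.1 p.2) := by
    rw [← Measure.compProd_withDensity hmeas]
    refine Measure.compProd_congr ?_
    filter_upwards [hac'] with a ha
    exact (Kernel.withDensity_rnDeriv_eq ha).symm
  have hrn : (μ ⊗ₘ κ).rnDeriv (μ ⊗ₘ η) =ᵐ[μ ⊗ₘ η] fun p ↦ κ.rnDeriv η p.1 p.2 := by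
    nth_rw 1 [hwd]
    exact Measure.rnDeriv_withDensity _ hmeas
  rw [klDiv_eq_lintegral_klFun_of_ac hac,
    lintegral_congr_ae (g := fun p ↦ ENNReal.ofReal (klFun (κ.rnDeriv η p.1 p.2).toReal))
      (hrn.mono fun p hp ↦ by simp only [hp]),
    Measure.lintegral_compProd (f := fun p ↦ ENNReal.ofReal (klFun (κ.rnDeriv η p.1 p.2).toReal))
      (measurable_klFun.comp hmeas.ennreal_toReal).ennreal_ofReal]
  refine lintegral_mono_ae ?_
  filter_upwards [hac'] with a ha
  rw [klDiv_eq_lintegral_klFun_of_ac ha]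
  refine (lintegral_congr_ae ?_).le
  filter_upwards [Kernel.rnDeriv_eq_rnDeriv_measure (κ := κ) (η := η) (a := a)] with b hb
  simp only [hb]

/-- Pushing forward the first variable of a composition-product. -/
lemma map_compProd_comap {α β γ : Type*} [MeasurableSpace α] [MeasurableSpace β]
    [MeasurableSpace γ] (μ : Measure α) [SFinite μ] {f : α → β} (hf : Measurable f)
    (κ : Kernel β γ) [IsSFiniteKernel κ] :
    (μ ⊗ₘ κ.comap f hf).map (Prod.map f id) = μ.map f ⊗ₘ κ := by
  refine Measure.ext_of_lintegral _ fun g hg ↦ ?_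
  rw [lintegral_map hg (by fun_prop), Measure.lintegral_compProd (by fun_prop),
    Measure.lintegral_compProd hg, lintegral_map (by fun_prop) hf]
  simp

/-- Lower semicontinuity of the integral of a lower semicontinuous function under weak
convergence. -/
lemma lintegral_le_liminf_of_lowerSemicontinuous {Ω : Type*} [MeasurableSpace Ω]
    [TopologicalSpace Ω] [OpensMeasurableSpace Ω] {μ : Measure Ω} {μs : ℕ → Measure Ω}
    {f : Ω → ℝ≥0∞} (hf : LowerSemicontinuous f)
    (h_opens : ∀ G, IsOpen G → μ G ≤ liminf (fun i ↦ μs i G) atTop) :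
    ∫⁻ x, f x ∂μ ≤ liminf (fun i ↦ ∫⁻ x, f x ∂(μs i)) atTop := by
  have hcut (N : ℕ) (ν : Measure Ω) : ∫⁻ x, min (f x) N ∂ν =
      ∫⁻ t in Set.Ioi (0 : ℝ), ν {a | t < (min (f a) N).toReal} := by
    rw [← lintegral_eq_lintegral_meas_lt _ (Eventually.of_forall fun _ ↦ toReal_nonneg)
      (hf.measurable.min measurable_const).ennreal_toReal.aemeasurable]
    exact lintegral_congr fun x ↦
      (ENNReal.ofReal_toReal (min_lt_of_right_lt (natCast_lt_top N)).ne).symm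
  have hopen (N : ℕ) (t : ℝ) (ht : t ∈ Set.Ioi (0 : ℝ)) :
      IsOpen {a | t < (min (f a) N).toReal} := by
    have : {a | t < (min (f a) N).toReal} =
        if t < N then f ⁻¹' Set.Ioi (ENNReal.ofReal t) else ∅ := by
      ext a
      have hfin : min (f a) N ≠ ⊤ := (min_lt_of_right_lt (natCast_lt_top N)).ne
      rw [Set.mem_ofPred_eq, ← ENNReal.ofReal_lt_iff_lt_toReal (le_of_lt ht) hfin, lt_min_iff]
      split_ifs with h
      · have hN : N ≠ 0 := by
          rintro rfl
          exact lt_asymm (Set.mem_Ioi.1 ht) (by simpa using h)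
        simpa using fun _ ↦ (ENNReal.ofReal_lt_natCast hN).2 h
      · simp only [Set.mem_empty_iff_false, iff_false, not_and]
        intro _ h'
        rw [ENNReal.ofReal_lt_iff_lt_toReal (le_of_lt ht) (natCast_ne_top N)] at h'
        exact h (by simpa using h')
    rw [this]
    split_ifs
    · exact hf.isOpen_preimage _
    · exact isOpen_empty
  have hmono (x : Ω) : f x = ⨆ N : ℕ, min (f x) N := by
    have := inf_iSup_eq (f x) (fun N : ℕ ↦ (N : ℝ≥0∞))
    rw [ENNReal.iSup_natCast, inf_top_eq] at this
    exact this
  calc ∫⁻ x, f x ∂μ = ⨆ N : ℕ, ∫⁻ x, min (f x) N ∂μ := by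
        rw [← lintegral_iSup (fun N ↦ hf.measurable.min measurable_const)]
        · exact lintegral_congr hmono
        · exact fun N M h x ↦ min_le_min_left _ (by exact_mod_cast h)
    _ ≤ liminf (fun i ↦ ∫⁻ x, f x ∂(μs i)) atTop := by
        refine iSup_le fun N ↦ ?_
        calc ∫⁻ x, min (f x) N ∂μ
            ≤ ∫⁻ t in Set.Ioi (0 : ℝ),
                liminf (fun i ↦ μs i {a | t < (min (f a) N).toReal}) atTop := by
              rw [hcut]
              exact setLIntegral_mono' measurableSet_Ioi fun t ht ↦ h_opens _ (hopen N t ht)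
          _ ≤ liminf (fun i ↦ ∫⁻ x, min (f x) N ∂(μs i)) atTop := by
              simp_rw [hcut]
              exact lintegral_liminf_le fun n ↦ Antitone.measurable fun s t hst ↦
                measure_mono fun ω hω ↦ lt_of_le_of_lt hst hω
          _ ≤ _ := liminf_le_liminf (Eventually.of_forall fun i ↦
              lintegral_mono fun x ↦ min_le_left _ _)


/-- The chain rule for the divergence from a product measure. -/
lemma klDiv_prod_eq_add {E F : Type*} [MeasurableSpace E] [MeasurableSpace F]
    [StandardBorelSpace F] [Nonempty F] (ν : Measure (E × F)) (μ₁ : Measure E) (μ₂ : Measure F)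
    [IsProbabilityMeasure ν] [IsProbabilityMeasure μ₁] [IsProbabilityMeasure μ₂] :
    klDiv ν (μ₁.prod μ₂) = klDiv ν.fst μ₁ + klDiv ν (ν.fst.prod μ₂) := by
  have h := klDiv_compProd_eq_add (μ := ν.fst) (ν := μ₁) (κ := ν.condKernel)
    (η := Kernel.const E μ₂)
  rwa [Measure.disintegrate, Measure.compProd_const, Measure.compProd_const] at h

/-- A transport inequality for the second variable, conditionally on a countable partition of
the first variable. -/
lemma exists_coupling_of_partition {E₁ E₂ F ι : Type*} [MeasurableSpace E₁] [MeasurableSpace E₂]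
    [StandardBorelSpace E₂] [Nonempty E₂] [MeasurableSpace F] [StandardBorelSpace F] [Nonempty F]
    [MeasurableSpace ι] [Countable ι] [MeasurableSingletonClass ι]
    {μ₂ : Measure E₂} {μt₂ : Measure F} [IsProbabilityMeasure μ₂] [IsProbabilityMeasure μt₂]
    {c : E₂ → F → ℝ≥0∞} (hc : Measurable fun p : E₂ × F ↦ c p.1 p.2)
    (h : ∀ ν : Measure E₂, IsProbabilityMeasure ν → transportCost c ν μt₂ ≤ klDiv ν μ₂)
    (ν : Measure (E₁ × E₂)) [IsProbabilityMeasure ν] {ε : ℝ≥0∞} (hε : ε ≠ 0)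
    {k : E₁ → ι} (hk : Measurable k) :
    ∃ Q : Measure ((E₁ × E₂) × F), Q.fst = ν ∧
      Q.map (fun q ↦ (k q.1.1, q.2)) = (ν.fst.map k).prod μt₂ ∧
      ∫⁻ q, c q.1.2 q.2 ∂Q ≤ klDiv ν (ν.fst.prod μ₂) + ε := by
  have hf : Measurable (Prod.map k id : E₁ × E₂ → ι × E₂) := hk.prodMap measurable_id
  set ρ : Measure (ι × E₂) := ν.map (Prod.map k id) with hρ
  have : IsProbabilityMeasure ρ := Measure.isProbabilityMeasure_map hf.aemeasurable
  have hρfst : ρ.fst = ν.fst.map k := by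
    rw [hρ, Measure.fst, Measure.fst, Measure.map_map measurable_fst hf,
      Measure.map_map hk measurable_fst]
    rfl
  choose P hP1 hP2 hP3 using fun i : ι ↦
    exists_coupling_le (h (ρ.condKernel i) inferInstance) hε
  let K : Kernel ι (E₂ × F) := Kernel.ofFunOfCountable P
  have hKP (i : ι) : K i = P i := rfl
  have : IsMarkovKernel K := ⟨fun i ↦ ⟨by
    rw [hKP, ← Measure.fst_univ, hP1, measure_univ]⟩⟩
  have hKfst : K.fst = ρ.condKernel := by
    ext1 i
    rw [Kernel.fst_apply, hKP]
    exact hP1 i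
  have hKsnd : K.snd = Kernel.const ι μt₂ := by
    ext1 i
    rw [Kernel.snd_apply, hKP]
    exact hP2 i
  let Q : Measure ((E₁ × E₂) × F) := ν ⊗ₘ K.condKernel.comap (Prod.map k id) hf
  have hQ : Q.map (Prod.map (Prod.map k id) id) = ρ ⊗ₘ K.condKernel := map_compProd_comap ν hf _
  have hQ' : (Q.map (Prod.map (Prod.map k id) id)).map MeasurableEquiv.prodAssoc =
      ρ.fst ⊗ₘ K := by
    rw [hQ]
    conv_lhs => rw [← ρ.disintegrate ρ.condKernel, ← hKfst]
    rw [Measure.compProd_assoc', Kernel.disintegrate]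
  have hgm : Measurable (MeasurableEquiv.prodAssoc ∘ Prod.map (Prod.map k id) id :
      (E₁ × E₂) × F → ι × E₂ × F) :=
    MeasurableEquiv.prodAssoc.measurable.comp (hf.prodMap measurable_id)
  rw [Measure.map_map MeasurableEquiv.prodAssoc.measurable (hf.prodMap measurable_id)] at hQ'
  refine ⟨Q, Measure.fst_compProd _ _, ?_, ?_⟩
  · calc Q.map (fun q ↦ (k q.1.1, q.2))
        = (ρ.fst ⊗ₘ K).map (Prod.map id Prod.snd) := by
          rw [← hQ', Measure.map_map (by fun_prop) hgm]
          rfl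
      _ = ρ.fst ⊗ₘ K.snd := by
          rw [Kernel.snd_eq, Measure.compProd_map measurable_snd]
      _ = _ := by rw [hKsnd, Measure.compProd_const, hρfst]
  · calc ∫⁻ q, c q.1.2 q.2 ∂Q = ∫⁻ q, c q.2.1 q.2.2 ∂(ρ.fst ⊗ₘ K) := by
          rw [← hQ', lintegral_map (f := fun q ↦ c q.2.1 q.2.2) (hc.comp measurable_snd) hgm]
          rfl
      _ = ∫⁻ i, ∫⁻ p, c p.1 p.2 ∂(K i) ∂ρ.fst :=
          Measure.lintegral_compProd (hc.comp measurable_snd)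
      _ ≤ ∫⁻ i, klDiv (ρ.condKernel i) (Kernel.const ι μ₂ i) + ε ∂ρ.fst :=
          lintegral_mono fun i ↦ hP3 i
      _ = ∫⁻ i, klDiv (ρ.condKernel i) (Kernel.const ι μ₂ i) ∂ρ.fst + ε := by
          rw [lintegral_add_right _ measurable_const]; simp
      _ ≤ klDiv (ρ.fst ⊗ₘ ρ.condKernel) (ρ.fst ⊗ₘ Kernel.const ι μ₂) + ε := by
          gcongr
          exact lintegral_klDiv_le_klDiv_compProd _ _ _
      _ = klDiv (ν.map (Prod.map k id)) ((ν.fst.prod μ₂).map (Prod.map k id)) + ε := by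
          rw [Measure.disintegrate, Measure.compProd_const, hρfst,
            ← Measure.map_prod_map _ _ hk measurable_id, Measure.map_id]
      _ ≤ klDiv ν (ν.fst.prod μ₂) + ε := by
          gcongr
          exact klDiv_map_le _ _ hf

/-- A countably generated measurable space is generated by the sets that are eventually saturated
for a sequence of measurable maps to finite spaces. -/
lemma exists_seq_measurable_finite (E : Type*) [m : MeasurableSpace E]
    [MeasurableSpace.CountablyGenerated E] :
    ∃ k : ∀ n : ℕ, E → (Fin n → Prop), (∀ n, Measurable (k n)) ∧
      MeasurableSpace.generateFrom {A | ∀ᶠ n in atTop, ∃ S, k n ⁻¹' S = A} = m := by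
  let t := MeasurableSpace.natGeneratingSequence E
  have hk (n : ℕ) : Measurable fun (x : E) (i : Fin n) ↦ x ∈ t i :=
    measurable_pi_iff.2 fun i ↦
      measurableSet_setOfPred.1 (MeasurableSpace.measurableSet_natGeneratingSequence i)
  refine ⟨fun n x i ↦ x ∈ t i, hk, le_antisymm ?_ ?_⟩
  · refine MeasurableSpace.generateFrom_le fun A hA ↦ ?_
    obtain ⟨n, S, rfl⟩ := Eventually.exists hA
    exact hk n S.to_countable.measurableSet
  · conv_lhs => rw [← MeasurableSpace.generateFrom_natGeneratingSequence E]
    refine MeasurableSpace.generateFrom_mono ?_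
    rintro _ ⟨i, rfl⟩
    filter_upwards [eventually_gt_atTop i] with n hn
    exact ⟨{v | v ⟨i, hn⟩}, rfl⟩

/-- A sequence of couplings of two fixed measures has a convergent subsequence. -/
lemma exists_tendsto_subseq_of_marginals {X Y : Type*}
    [TopologicalSpace X] [PolishSpace X] [MeasurableSpace X] [BorelSpace X]
    [TopologicalSpace Y] [PolishSpace Y] [MeasurableSpace Y] [BorelSpace Y]
    {ν : Measure X} {μ : Measure Y} [IsProbabilityMeasure ν] [IsProbabilityMeasure μ]
    (Q : ℕ → ProbabilityMeasure (X × Y)) (h1 : ∀ n, (Q n : Measure (X × Y)).fst = ν)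
    (h2 : ∀ n, (Q n : Measure (X × Y)).snd = μ) :
    ∃ R : ProbabilityMeasure (X × Y), ∃ φ : ℕ → ℕ, StrictMono φ ∧
      Tendsto (Q ∘ φ) atTop (𝓝 R) := by
  have htight : IsTightMeasureSet
      {x : Measure (X × Y) | ∃ P ∈ Set.range Q, (P : Measure (X × Y)) = x} := by
    refine IsTightMeasureSet.prodMk ?_ ?_
    · refine (isTightMeasureSet_singleton (μ := ν)).subset ?_
      rintro _ ⟨_, ⟨_, ⟨n, rfl⟩, rfl⟩, rfl⟩
      exact h1 n
    · refine (isTightMeasureSet_singleton (μ := μ)).subset ?_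
      rintro _ ⟨_, ⟨_, ⟨n, rfl⟩, rfl⟩, rfl⟩
      exact h2 n
  obtain ⟨R, -, φ, hφ, hR⟩ := (isCompact_closure_of_isTightMeasureSet htight).tendsto_subseq
    fun n ↦ subset_closure (Set.mem_range_self n)
  exact ⟨R, φ, hφ, hR⟩

/-- If the measures of a weakly convergent sequence have the same image under a continuous map,
then so does the limit. -/
lemma map_eq_of_tendsto {X Y : Type*}
    [TopologicalSpace X] [MeasurableSpace X] [OpensMeasurableSpace X]
    [TopologicalSpace Y] [HasOuterApproxClosed Y] [MeasurableSpace Y] [BorelSpace Y]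
    {Q : ℕ → ProbabilityMeasure X} {R : ProbabilityMeasure X} (hQ : Tendsto Q atTop (𝓝 R))
    {f : X → Y} (hf : Continuous f) {μ : Measure Y}
    (h : ∀ n, (Q n : Measure X).map f = μ) : (R : Measure X).map f = μ := by
  have hlim := ProbabilityMeasure.tendsto_map_of_tendsto_of_continuous Q R hQ hf
  have hconst (n : ℕ) : (Q n).map hf.measurable.aemeasurable =
      (Q 0).map hf.measurable.aemeasurable :=
    Subtype.ext ((h n).trans (h 0).symm)
  rw [tendsto_congr hconst] at hlim
  exact (congrArg (fun P : ProbabilityMeasure Y ↦ (P : Measure Y))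
    (tendsto_nhds_unique hlim tendsto_const_nhds)).trans (h 0)

/-- A weak limit of couplings that are eventually independent on rectangles `A ×ˢ B`, for `A` in a
generating algebra of sets, is a product measure. -/
lemma eq_prod_of_tendsto {X Y : Type*}
    [TopologicalSpace X] [PolishSpace X] [MeasurableSpace X] [BorelSpace X]
    [TopologicalSpace Y] [PolishSpace Y] [MeasurableSpace Y] [BorelSpace Y]
    {ν : Measure X} {μ : Measure Y} [IsProbabilityMeasure ν] [IsProbabilityMeasure μ]
    {Q : ℕ → ProbabilityMeasure (X × Y)} {R : ProbabilityMeasure (X × Y)}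
    (hQ : Tendsto Q atTop (𝓝 R)) (h1 : ∀ n, (Q n : Measure (X × Y)).fst = ν)
    (h2 : ∀ n, (Q n : Measure (X × Y)).snd = μ) {C : Set (Set X)}
    (hC : MeasurableSpace.generateFrom C = ‹MeasurableSpace X›) (hC_pi : IsPiSystem C)
    (hC_univ : Set.univ ∈ C) (hC_compl : ∀ A ∈ C, Aᶜ ∈ C)
    (hind : ∀ A ∈ C, ∀ᶠ n in atTop, ∀ B, MeasurableSet B →
      (Q n : Measure (X × Y)) (A ×ˢ B) = ν A * μ B) :
    (R : Measure (X × Y)) = ν.prod μ := by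
  have hCm : ∀ A ∈ C, MeasurableSet A := fun A hA ↦
    hC ▸ MeasurableSpace.measurableSet_generateFrom hA
  have hle : ∀ A ∈ C, ∀ G, IsOpen G → (R : Measure (X × Y)) (A ×ˢ G) ≤ ν A * μ G := by
    intro A hA G hG
    refine ENNReal.le_of_forall_pos_le_add fun ε hε _ ↦ ?_
    obtain ⟨U, hAU, hU, hUε⟩ := A.exists_isOpen_le_add ν (ENNReal.coe_ne_zero.2 hε.ne')
    have hdiff : ν (U \ A) ≤ ε := by
      rw [measure_sdiff hAU (hCm A hA).nullMeasurableSet (measure_ne_top _ _)]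
      exact tsub_le_iff_left.2 hUε
    calc (R : Measure (X × Y)) (A ×ˢ G) ≤ (R : Measure (X × Y)) (U ×ˢ G) :=
          measure_mono (Set.prod_mono_left hAU)
      _ ≤ liminf (fun n ↦ (Q n : Measure (X × Y)) (U ×ˢ G)) atTop :=
          ProbabilityMeasure.le_liminf_measure_open_of_tendsto hQ (hU.prod hG)
      _ ≤ ν A * μ G + ε := by
          refine liminf_le_of_frequently_le' (Eventually.frequently ?_)
          filter_upwards [hind A hA] with n hn
          have hsub : U ×ˢ G ⊆ A ×ˢ G ∪ Prod.fst ⁻¹' (U \ A) := by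
            rintro ⟨x, y⟩ ⟨hx, hy⟩
            by_cases hxA : x ∈ A
            · exact Or.inl ⟨hxA, hy⟩
            · exact Or.inr ⟨hx, hxA⟩
          refine (measure_mono hsub).trans ((measure_union_le _ _).trans ?_)
          rw [hn G hG.measurableSet,
            ← Measure.fst_apply (hU.measurableSet.diff (hCm A hA)), h1]
          gcongr
  have hsnd : (R : Measure (X × Y)).snd = μ := map_eq_of_tendsto hQ continuous_snd h2
  refine (Measure.prod_eq_generateFrom hC (BorelSpace.measurable_eq (α := Y)).symm hC_pi
    isPiSystem_isOpen ⟨fun _ ↦ Set.univ, fun _ ↦ hC_univ, fun _ ↦ measure_lt_top _ _,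
      Set.iUnion_const _⟩ ⟨fun _ ↦ Set.univ, fun _ ↦ isOpen_univ, fun _ ↦ measure_lt_top _ _,
      Set.iUnion_const _⟩ fun A hA G hG ↦ ?_).symm
  refine le_antisymm (hle A hA G hG) ?_
  have hsplit : ν A * μ G + ν Aᶜ * μ G ≤
      (R : Measure (X × Y)) (A ×ˢ G) + ν Aᶜ * μ G := by
    calc ν A * μ G + ν Aᶜ * μ G = μ G := by
          rw [← add_mul, measure_add_measure_compl (hCm A hA), measure_univ, one_mul]
      _ = (R : Measure (X × Y)) (Prod.snd ⁻¹' G) := by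
          rw [← Measure.snd_apply hG.measurableSet, hsnd]
      _ ≤ (R : Measure (X × Y)) (A ×ˢ G ∪ Aᶜ ×ˢ G) := by
          refine measure_mono fun p hp ↦ ?_
          by_cases hpA : p.1 ∈ A
          · exact Or.inl ⟨hpA, hp⟩
          · exact Or.inr ⟨hpA, hp⟩
      _ ≤ _ := (measure_union_le _ _).trans (by gcongr; exact hle _ (hC_compl A hA) G hG)
  exact (ENNReal.add_le_add_iff_right (by finiteness)).1 hsplit

/-- A transport inequality for the second variable, conditionally on the first variable. -/
lemma exists_conditional_coupling {E₁ E₂ F : Type*}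
    [TopologicalSpace E₁] [PolishSpace E₁] [MeasurableSpace E₁] [BorelSpace E₁]
    [TopologicalSpace E₂] [PolishSpace E₂] [MeasurableSpace E₂] [BorelSpace E₂] [Nonempty E₂]
    [TopologicalSpace F] [PolishSpace F] [MeasurableSpace F] [BorelSpace F] [Nonempty F]
    {μ₂ : Measure E₂} {μt₂ : Measure F} [IsProbabilityMeasure μ₂] [IsProbabilityMeasure μt₂]
    {c : E₂ → F → ℝ≥0∞} (hc : LowerSemicontinuous fun p : E₂ × F ↦ c p.1 p.2)
    (h : ∀ ν : Measure E₂, IsProbabilityMeasure ν → transportCost c ν μt₂ ≤ klDiv ν μ₂)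
    (ν : Measure (E₁ × E₂)) [IsProbabilityMeasure ν] {ε : ℝ≥0∞} (hε : ε ≠ 0) :
    ∃ Q : Measure ((E₁ × E₂) × F), Q.fst = ν ∧
      Q.map (fun q ↦ (q.1.1, q.2)) = ν.fst.prod μt₂ ∧
      ∫⁻ q, c q.1.2 q.2 ∂Q ≤ klDiv ν (ν.fst.prod μ₂) + ε := by
  obtain ⟨k, hk, hgen⟩ := exists_seq_measurable_finite E₁
  choose Q hQ1 hQ2 hQ3 using fun n ↦ exists_coupling_of_partition hc.measurable h ν hε (hk n)
  have hkm (n : ℕ) : Measurable fun q : (E₁ × E₂) × F ↦ (k n q.1.1, q.2) :=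
    ((hk n).comp (measurable_fst.comp measurable_fst)).prodMk measurable_snd
  have hQp (n : ℕ) : IsProbabilityMeasure (Q n) :=
    ⟨by rw [← Measure.fst_univ, hQ1, measure_univ]⟩
  have hQsnd (n : ℕ) : (Q n).snd = μt₂ := by
    have : IsProbabilityMeasure (ν.fst.map (k n)) :=
      Measure.isProbabilityMeasure_map (hk n).aemeasurable
    calc (Q n).snd = ((Q n).map (fun q ↦ (k n q.1.1, q.2))).snd := by
          rw [Measure.snd, Measure.snd, Measure.map_map measurable_snd (hkm n)]
          rfl
      _ = μt₂ := by rw [hQ2, Measure.snd_prod]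
  let P (n : ℕ) : ProbabilityMeasure ((E₁ × E₂) × F) := ⟨Q n, hQp n⟩
  obtain ⟨R, φ, hφ, hR⟩ := exists_tendsto_subseq_of_marginals P hQ1 hQsnd
  have hcont : Continuous fun q : (E₁ × E₂) × F ↦ (q.1.1, q.2) := by fun_prop
  refine ⟨R, map_eq_of_tendsto hR continuous_fst fun n ↦ hQ1 (φ n), ?_, ?_⟩
  · have hlim := ProbabilityMeasure.tendsto_map_of_tendsto_of_continuous _ R hR hcont
    refine eq_prod_of_tendsto hlim (fun n ↦ ?_) (fun n ↦ ?_) hgen ?_ ?_ ?_ ?_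
    · change ((Q (φ n)).map (fun q ↦ (q.1.1, q.2))).fst = ν.fst
      rw [← hQ1 (φ n), Measure.fst, Measure.fst, Measure.fst,
        Measure.map_map measurable_fst hcont.measurable,
        Measure.map_map measurable_fst measurable_fst]
      rfl
    · change ((Q (φ n)).map (fun q ↦ (q.1.1, q.2))).snd = μt₂
      rw [← hQsnd (φ n), Measure.snd, Measure.snd,
        Measure.map_map measurable_snd hcont.measurable]
      rfl
    · intro A hA B hB _
      filter_upwards [hA, hB] with n ⟨S, hS⟩ ⟨T, hT⟩
      exact ⟨S ∩ T, by rw [Set.preimage_inter, hS, hT]⟩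
    · exact Eventually.of_forall fun n ↦ ⟨Set.univ, Set.preimage_univ⟩
    · intro A hA
      filter_upwards [hA] with n ⟨S, hS⟩
      exact ⟨Sᶜ, by rw [Set.preimage_compl, hS]⟩
    · intro A hA
      filter_upwards [hφ.tendsto_atTop.eventually hA] with n ⟨S, hS⟩ B hB
      have hSm : MeasurableSet S := S.to_countable.measurableSet
      subst hS
      change (Q (φ n)).map (fun q ↦ (q.1.1, q.2)) _ = _
      rw [Measure.map_apply hcont.measurable ((hk _ hSm).prod hB), ← Measure.map_apply (hk _) hSm,
        ← Measure.prod_prod, ← hQ2 (φ n), Measure.map_apply (hkm _) (hSm.prod hB)]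
      rfl
  · have hlsc : LowerSemicontinuous fun q : (E₁ × E₂) × F ↦ c q.1.2 q.2 :=
      hc.comp (f := fun p : E₂ × F ↦ c p.1 p.2)
        (g := fun q : (E₁ × E₂) × F ↦ (q.1.2, q.2)) (by fun_prop)
    refine (lintegral_le_liminf_of_lowerSemicontinuous hlsc fun G hG ↦
      ProbabilityMeasure.le_liminf_measure_open_of_tendsto hR hG).trans ?_
    exact liminf_le_of_frequently_le' (Eventually.frequently
      (Eventually.of_forall fun n ↦ hQ3 (φ n)))

/-- Gluing of a coupling of the first coordinates and a coupling of the second coordinates that is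
independent of the first coordinate. -/
lemma exists_glued_coupling {E₁ E₂ F₁ F₂ : Type*} [MeasurableSpace E₁]
    [MeasurableSpace E₂] [StandardBorelSpace E₂] [Nonempty E₂] [MeasurableSpace F₁]
    [MeasurableSpace F₂] [StandardBorelSpace F₂] [Nonempty F₂] {ν : Measure (E₁ × E₂)}
    {μt₁ : Measure F₁} {μt₂ : Measure F₂} [IsProbabilityMeasure ν] [IsProbabilityMeasure μt₁]
    [IsProbabilityMeasure μt₂] {σ : Measure (E₁ × F₁)} (hσ1 : σ.fst = ν.fst) (hσ2 : σ.snd = μt₁)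
    {Q : Measure ((E₁ × E₂) × F₂)} (hQ1 : Q.fst = ν)
    (hQ2 : Q.map (fun q ↦ (q.1.1, q.2)) = ν.fst.prod μt₂) :
    ∃ P : Measure ((E₁ × E₂) × (F₁ × F₂)), P.fst = ν ∧ P.snd = μt₁.prod μt₂ ∧
      P.map (fun p ↦ (p.1.1, p.2.1)) = σ ∧ P.map (fun p ↦ (p.1, p.2.2)) = Q := by
  have : IsProbabilityMeasure σ := ⟨by rw [← Measure.fst_univ, hσ1, measure_univ]⟩
  have : IsProbabilityMeasure Q := ⟨by rw [← Measure.fst_univ, hQ1, measure_univ]⟩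
  let Q' : Measure (E₁ × E₂ × F₂) := Q.map MeasurableEquiv.prodAssoc
  have : IsProbabilityMeasure Q' :=
    Measure.isProbabilityMeasure_map MeasurableEquiv.prodAssoc.measurable.aemeasurable
  have hQ'fst : Q'.fst = ν.fst := by
    rw [← hQ1, Measure.fst, Measure.map_map measurable_fst MeasurableEquiv.prodAssoc.measurable,
      Measure.fst, Measure.fst, Measure.map_map measurable_fst measurable_fst]
    rfl
  let η := Q'.condKernel
  have hη : ν.fst ⊗ₘ η = Q' := by rw [← hQ'fst, Measure.disintegrate]
  have hηsnd : η.snd =ᵐ[ν.fst] Kernel.const E₁ μt₂ := by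
    refine Kernel.ae_eq_of_compProd_eq ?_
    rw [Kernel.snd_eq, Measure.compProd_map measurable_snd, hη, Measure.compProd_const, ← hQ2,
      Measure.map_map (by fun_prop) MeasurableEquiv.prodAssoc.measurable]
    rfl
  let P' : Measure ((E₁ × F₁) × (E₂ × F₂)) := σ ⊗ₘ η.comap Prod.fst measurable_fst
  have hP'Q : P'.map (Prod.map Prod.fst id) = Q' := by
    rw [map_compProd_comap, ← Measure.fst, hσ1, hη]
  have hP'snd : P'.map (Prod.map id Prod.snd) = σ.prod μt₂ := by
    rw [← Measure.compProd_map measurable_snd, ← Measure.compProd_const]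
    refine Measure.compProd_congr ?_
    rw [← hσ1] at hηsnd
    filter_upwards [ae_of_ae_map measurable_fst.aemeasurable hηsnd] with x hx
    rw [Kernel.snd_eq] at hx
    rw [Kernel.const_apply, Kernel.map_apply _ measurable_snd, Kernel.comap_apply,
      ← Kernel.map_apply _ measurable_snd, hx, Kernel.const_apply]
  let g : (E₁ × F₁) × (E₂ × F₂) → (E₁ × E₂) × (F₁ × F₂) :=
    fun p ↦ ((p.1.1, p.2.1), (p.1.2, p.2.2))
  have hg : Measurable g := by fun_prop
  have hglue : (P'.map g).map (fun p ↦ (p.1, p.2.2)) = Q := by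
    calc (P'.map g).map (fun p ↦ (p.1, p.2.2))
        = (P'.map (Prod.map Prod.fst id)).map MeasurableEquiv.prodAssoc.symm := by
          rw [Measure.map_map (by fun_prop) hg,
            Measure.map_map MeasurableEquiv.prodAssoc.symm.measurable (by fun_prop)]
          rfl
      _ = Q := by rw [hP'Q, MeasurableEquiv.map_symm_map]
  refine ⟨P'.map g, ?_, ?_, ?_, hglue⟩
  · rw [← hQ1, ← hglue, Measure.fst, Measure.fst,
      Measure.map_map measurable_fst (by fun_prop : Measurable fun p : (E₁ × E₂) × (F₁ × F₂) ↦
        (p.1, p.2.2))]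
    rfl
  · calc (P'.map g).snd = (P'.map (Prod.map id Prod.snd)).map (Prod.map Prod.snd id) := by
          rw [Measure.snd, Measure.map_map measurable_snd hg,
            Measure.map_map (by fun_prop) (by fun_prop)]
          rfl
      _ = μt₁.prod μt₂ := by
          rw [hP'snd, ← Measure.map_prod_map _ _ measurable_snd measurable_id, Measure.map_id,
            ← Measure.snd, hσ2]
  · rw [Measure.map_map (by fun_prop) hg]
    exact Measure.fst_compProd _ _

end TransportEntropy

open TransportEntropy InformationTheory

/-- **Tensorization of transportation-entropy inequalities.** If for `i = 1, 2` the
inequality `W_{c_i}(ν, μ̃ᵢ) ≤ H(ν | μᵢ)` holds for all probability measures `ν` on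
`ℝ^{dᵢ}`, then `W_{c₁⊕c₂}(ν, μ̃₁ ⊗ μ̃₂) ≤ H(ν | μ₁ ⊗ μ₂)` for all probability measures
`ν` on `ℝ^{d₁} × ℝ^{d₂}`, where `(c₁ ⊕ c₂)((x₁,x₂),(y₁,y₂)) = c₁(x₁,y₁) + c₂(x₂,y₂)`. -/
theorem transport_entropy_tensorization (d₁ d₂ : ℕ)
    (μ₁ μt₁ : Measure (Fin d₁ → ℝ)) (μ₂ μt₂ : Measure (Fin d₂ → ℝ))
    [IsProbabilityMeasure μ₁] [IsProbabilityMeasure μt₁]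
    [IsProbabilityMeasure μ₂] [IsProbabilityMeasure μt₂]
    (c₁ : (Fin d₁ → ℝ) → (Fin d₁ → ℝ) → ℝ≥0∞) (c₂ : (Fin d₂ → ℝ) → (Fin d₂ → ℝ) → ℝ≥0∞)
    (hc₁ : LowerSemicontinuous (fun p : (Fin d₁ → ℝ) × (Fin d₁ → ℝ) => c₁ p.1 p.2))
    (hc₂ : LowerSemicontinuous (fun p : (Fin d₂ → ℝ) × (Fin d₂ → ℝ) => c₂ p.1 p.2))
    (h₁ : ∀ ν : Measure (Fin d₁ → ℝ), IsProbabilityMeasure ν →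
      transportCost c₁ ν μt₁ ≤ relEntropy ν μ₁)
    (h₂ : ∀ ν : Measure (Fin d₂ → ℝ), IsProbabilityMeasure ν →
      transportCost c₂ ν μt₂ ≤ relEntropy ν μ₂) :
    ∀ ν : Measure ((Fin d₁ → ℝ) × (Fin d₂ → ℝ)), IsProbabilityMeasure ν →
      transportCost (fun x y => c₁ x.1 y.1 + c₂ x.2 y.2) ν (μt₁.prod μt₂) ≤
        relEntropy ν (μ₁.prod μ₂) := by
  intro ν hν
  have : IsProbabilityMeasure ν := hν
  have h₁' : transportCost c₁ ν.fst μt₁ ≤ klDiv ν.fst μ₁ :=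
    (h₁ _ inferInstance).trans_eq (relEntropy_eq_klDiv _ _)
  have h₂' : ∀ ν : Measure (Fin d₂ → ℝ), IsProbabilityMeasure ν →
      transportCost c₂ ν μt₂ ≤ klDiv ν μ₂ :=
    fun ν hν ↦ (h₂ ν hν).trans_eq (relEntropy_eq_klDiv _ _)
  rw [relEntropy_eq_klDiv, klDiv_prod_eq_add]
  refine ENNReal.le_of_forall_pos_le_add fun ε hε _ ↦ ?_
  have hε2 : (ε : ℝ≥0∞) / 2 ≠ 0 := (ENNReal.half_pos (ENNReal.coe_ne_zero.2 hε.ne')).ne'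
  obtain ⟨σ, hσ1, hσ2, hσ⟩ := exists_coupling_le h₁' hε2
  obtain ⟨Q, hQ1, hQ2, hQ⟩ := exists_conditional_coupling hc₂ h₂' ν hε2
  obtain ⟨P, hP1, hP2, hPσ, hPQ⟩ := exists_glued_coupling hσ1 hσ2 hQ1 hQ2
  have hm₁ : Measurable fun p : (Fin d₁ → ℝ) × (Fin d₁ → ℝ) ↦ c₁ p.1 p.2 := hc₁.measurable
  have hm₂ : Measurable fun q : ((Fin d₁ → ℝ) × (Fin d₂ → ℝ)) × (Fin d₂ → ℝ) ↦ c₂ q.1.2 q.2 :=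
    hc₂.measurable.comp ((measurable_snd.comp measurable_fst).prodMk measurable_snd)
  calc transportCost (fun x y ↦ c₁ x.1 y.1 + c₂ x.2 y.2) ν (μt₁.prod μt₂)
      ≤ ∫⁻ p, (c₁ p.1.1 p.2.1 + c₂ p.1.2 p.2.2) ∂P := iInf_le_of_le P (iInf₂_le hP1 hP2)
    _ = ∫⁻ p, c₁ p.1.1 p.2.1 ∂P + ∫⁻ p, c₂ p.1.2 p.2.2 ∂P :=
        lintegral_add_left (hm₁.comp (by fun_prop : Measurable
          fun p : ((Fin d₁ → ℝ) × (Fin d₂ → ℝ)) × ((Fin d₁ → ℝ) × (Fin d₂ → ℝ)) ↦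
            (p.1.1, p.2.1))) _
    _ = ∫⁻ p, c₁ p.1 p.2 ∂σ + ∫⁻ q, c₂ q.1.2 q.2 ∂Q := by
        rw [← hPσ, ← hPQ, lintegral_map hm₁ (by fun_prop), lintegral_map hm₂ (by fun_prop)]
    _ ≤ (klDiv ν.fst μ₁ + ε / 2) + (klDiv ν (ν.fst.prod μ₂) + ε / 2) := add_le_add hσ hQ
    _ = klDiv ν.fst μ₁ + klDiv ν (ν.fst.prod μ₂) + ε := by
        rw [add_add_add_comm, ENNReal.add_halves]
end

section
/- Let γ be the standard Gaussian measure on ℝ^n and let f : ℝ^n → ℝ be continuously differentiable with V = ∇f(ℝ^n) such that e^f is γ-integrable, f(·+h) is γ-integrable for each h ∈ ℝ^n, and the Gaussian mean-width g(V) = E[ sup_{ξ∈V} ⟨ξ,Γ⟩ ] (Γ standard Gaussian on ℝ^n) is finite. Then sup_{h∈ℝ^n} ( ∫ f(x+h) dγ(x) - ‖h‖_{ℓ^2}²/2 ) ≤ log ∫ e^f dγ ≤ sup_{h∈ℝ^n} ( ∫ f(x+h) dγ(x) - ‖h‖_{ℓ^2}²/2 ) + √2 · g(V). -/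
open MeasureTheory Real Set ENNReal ProbabilityTheory
open scoped Classical

/-- The standard Gaussian measure on `ℝⁿ`. -/
noncomputable def stdGaussian (n : ℕ) : Measure (Fin n → ℝ) :=
  Measure.pi fun _ : Fin n => gaussianReal 0 1

/-- The gradient of `f : ℝⁿ → ℝ` as a vector. -/
noncomputable def gradVec (n : ℕ) (f : (Fin n → ℝ) → ℝ) (y : Fin n → ℝ) : Fin n → ℝ :=
  fun i => fderiv ℝ f y (Pi.single i 1)

open Filter Topology

section Transport

variable {p : ℝ → ℝ}

lemma hasDerivAt_setIntegral_Iic (hp : Continuous p) (hi : Integrable p) (t : ℝ) :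
    HasDerivAt (fun t => ∫ s in Iic t, p s) (p t) t := by
  have h (u : ℝ) : ∫ s in Iic u, p s = (∫ s in Iic 0, p s) + ∫ s in (0 : ℝ)..u, p s := by
    rw [← intervalIntegral.integral_Iic_sub_Iic hi.integrableOn hi.integrableOn]
    ring
  rw [funext h]
  exact (intervalIntegral.integral_hasDerivAt_right (hp.intervalIntegrable _ _)
    (hp.stronglyMeasurableAtFilter _ _) hp.continuousAt).const_add _

lemma strictMono_setIntegral_Iic (hp : Continuous p) (hi : Integrable p) (hpos : ∀ t, 0 < p t) :
    StrictMono (fun t => ∫ s in Iic t, p s) :=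
  strictMono_of_deriv_pos fun t => by
    rw [(hasDerivAt_setIntegral_Iic hp hi t).deriv]
    exact hpos t

lemma range_setIntegral_Iic (hp : Continuous p) (hi : Integrable p) (hpos : ∀ t, 0 < p t) :
    range (fun t => ∫ s in Iic t, p s) = Ioo 0 (∫ s, p s) := by
  have hmono := strictMono_setIntegral_Iic hp hi hpos
  have hcont : Continuous (fun t => ∫ s in Iic t, p s) :=
    continuous_iff_continuousAt.2 fun t => (hasDerivAt_setIntegral_Iic hp hi t).continuousAt
  have hbot : Tendsto (fun t => ∫ s in Iic t, p s) atBot (𝓝 0) :=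
    tendsto_integral_Iic_zero tendsto_id
  have htop : Tendsto (fun t => ∫ s in Iic t, p s) atTop (𝓝 (∫ s, p s)) :=
    (aecover_Iic tendsto_id).integral_tendsto_of_countably_generated hi
  apply Subset.antisymm
  · rintro _ ⟨t, rfl⟩
    exact ⟨(hmono.monotone.le_of_tendsto hbot (t - 1)).trans_lt (hmono (by linarith)),
      (hmono (show t < t + 1 by linarith)).trans_le (hmono.monotone.ge_of_tendsto htop (t + 1))⟩
  · rintro u ⟨hu0, hu1⟩
    obtain ⟨a, ha⟩ := (hbot.eventually_lt_const hu0).exists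
    obtain ⟨b, hb⟩ := (htop.eventually_const_lt hu1).exists
    exact mem_range_of_exists_le_of_exists_ge hcont ⟨a, ha.le⟩ ⟨b, hb.le⟩

/-- The increasing rearrangement of one positive continuous density onto another. -/
lemma exists_strictMono_transport {q : ℝ → ℝ} (hp : Continuous p) (hpi : Integrable p)
    (hpos : ∀ t, 0 < p t) (hq : Continuous q) (hqi : Integrable q) (hqpos : ∀ t, 0 < q t)
    (hpq : ∫ s, p s = ∫ s, q s) :
    ∃ T : ℝ → ℝ, StrictMono T ∧ ∀ x, HasDerivAt T (p x / q (T x)) x := by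
  set G : ℝ → ℝ := fun t => ∫ s in Iic t, q s with hG
  set H : ℝ → ℝ := fun t => ∫ s in Iic t, p s with hH
  have hGmono : StrictMono G := strictMono_setIntegral_Iic hq hqi hqpos
  have hHmono : StrictMono H := strictMono_setIntegral_Iic hp hpi hpos
  have hGrange : range G = Ioo 0 (∫ s, q s) := range_setIntegral_Iic hq hqi hqpos
  have hHmem (x : ℝ) : H x ∈ Ioo 0 (∫ s, q s) := by
    rw [← hpq, ← range_setIntegral_Iic hp hpi hpos]
    exact mem_range_self x
  set R : ℝ → ℝ := Function.invFun G with hR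
  have hGR {u : ℝ} (hu : u ∈ Ioo 0 (∫ s, q s)) : G (R u) = u :=
    Function.invFun_eq (by rwa [← hGrange] at hu)
  have hRG (t : ℝ) : R (G t) = t := Function.leftInverse_invFun hGmono.injective t
  have hRmono : StrictMonoOn R (Ioo 0 (∫ s, q s)) := fun u hu v hv huv => by
    rw [← hGmono.lt_iff_lt, hGR hu, hGR hv]
    exact huv
  have hRimage : R '' Ioo 0 (∫ s, q s) = univ :=
    eq_univ_of_forall fun t => ⟨G t, hGrange ▸ mem_range_self t, hRG t⟩
  refine ⟨fun x => R (H x), fun x y hxy => hRmono (hHmem x) (hHmem y) (hHmono hxy), fun x => ?_⟩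
  have hnhds := isOpen_Ioo.mem_nhds (hHmem x)
  have hRcont : ContinuousAt R (H x) :=
    continuousAt_of_monotoneOn_of_image_mem_nhds hRmono.monotoneOn hnhds (by simp [hRimage])
  have hRderiv : HasDerivAt R (q (R (H x)))⁻¹ (H x) :=
    (hasDerivAt_setIntegral_Iic hq hqi (R (H x))).of_local_left_inverse hRcont (hqpos _).ne'
      (eventually_of_mem hnhds fun u hu => hGR hu)
  have := hRderiv.comp x (hasDerivAt_setIntegral_Iic hp hpi x)
  rwa [mul_comm, ← div_eq_mul_inv] at this

end Transport

section OneDimensional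

local notation "γ₁" => gaussianReal 0 1

lemma integrable_gaussianReal_iff {f : ℝ → ℝ} :
    Integrable f γ₁ ↔ Integrable (fun x => gaussianPDFReal 0 1 x * f x) := by
  rw [gaussianReal_of_var_ne_zero 0 one_ne_zero,
    integrable_withDensity_iff_integrable_smul' (measurable_gaussianPDF 0 1)
      (ae_of_all _ fun x => gaussianPDF_lt_top)]
  simp [gaussianPDF, ENNReal.toReal_ofReal (gaussianPDFReal_nonneg 0 1 _)]

lemma integral_gaussianReal_eq {f : ℝ → ℝ} :
    ∫ x, f x ∂γ₁ = ∫ x, gaussianPDFReal 0 1 x * f x := by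
  simp [integral_gaussianReal_eq_integral_smul (one_ne_zero (α := NNReal))]

lemma gaussianPDFReal_zero_one (x : ℝ) :
    gaussianPDFReal 0 1 x = (√(2 * π))⁻¹ * rexp (-x ^ 2 / 2) := by
  simp [gaussianPDFReal]

lemma continuous_gaussianPDFReal_zero_one : Continuous (gaussianPDFReal 0 1) := by
  rw [gaussianPDFReal_def]
  fun_prop

/-- A one-dimensional Gaussian Prékopa–Leindler inequality with one trivial function. -/
lemma rpow_integral_exp_gaussianReal_le {f φ : ℝ → ℝ} (hf : Continuous f)
    (hfi : Integrable (fun x => rexp (f x)) γ₁) {l : ℝ} (hl0 : 0 < l) (hl1 : l < 1)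
    (hφi : Integrable (fun x => rexp (l * φ x)) γ₁)
    (h : ∀ x y, f y ≤ φ x + (x - y) ^ 2 / 2) :
    (∫ x, rexp (f x) ∂γ₁) ^ l ≤ ∫ x, rexp (l * φ x) ∂γ₁ := by
  set g := gaussianPDFReal 0 1 with hg
  have hgpos (x : ℝ) : 0 < g x := gaussianPDFReal_pos 0 1 x one_ne_zero
  have hgc : Continuous g := continuous_gaussianPDFReal_zero_one
  set Z := ∫ x, rexp (f x) ∂γ₁ with hZ
  have hZpos : 0 < Z := integral_exp_pos hfi
  obtain ⟨T, hTmono, hT⟩ := exists_strictMono_transport (p := fun x => Z * g x)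
    (q := fun x => g x * rexp (f x)) (by fun_prop) ((integrable_gaussianPDFReal 0 1).const_mul Z)
    (fun x => mul_pos hZpos (hgpos x)) (by fun_prop) (integrable_gaussianReal_iff.1 hfi)
    (fun x => mul_pos (hgpos x) (exp_pos _))
    (by rw [integral_const_mul, integral_gaussianPDFReal_eq_one 0 one_ne_zero, mul_one, hZ,
      integral_gaussianReal_eq])
  set T' : ℝ → ℝ := fun x => Z * g x / (g (T x) * rexp (f (T x))) with hT'
  have hT'pos (x : ℝ) : 0 < T' x := by have := hgpos x; have := hgpos (T x); positivity
  set U : ℝ → ℝ := fun x => (1 - l) * x + l * T x with hU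
  have hUmono : StrictMono U := fun x y hxy => by
    have h1 := mul_lt_mul_of_pos_left hxy (sub_pos.2 hl1)
    have h2 := mul_lt_mul_of_pos_left (hTmono hxy) hl0
    simp only [hU]
    linarith
  have hUderiv (x : ℝ) : HasDerivAt U ((1 - l) + l * T' x) x := by
    simpa only [mul_one] using ((hasDerivAt_id' x).const_mul (1 - l)).fun_add ((hT x).const_mul l)
  have hφi' := integrable_gaussianReal_iff.1 hφi
  have key (x : ℝ) : Z ^ l * g x ≤
      |(1 - l) + l * T' x| • (g (U x) * rexp (l * φ (U x))) := by
    have hamgm : T' x ^ l ≤ (1 - l) + l * T' x := by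
      have := geom_mean_le_arith_mean2_weighted (sub_nonneg.2 hl1.le) hl0.le zero_le_one
        (hT'pos x).le (by ring)
      simpa using this
    have hφ : l * f (T x) - l * (1 - l) * (x - T x) ^ 2 / 2 ≤ l * φ (U x) := by
      have h1 := mul_le_mul_of_nonneg_left (h (U x) (T x)) hl0.le
      have h2 : U x - T x = (1 - l) * (x - T x) := by simp only [hU]; ring
      rw [h2] at h1
      nlinarith [mul_nonneg (mul_nonneg (mul_nonneg hl0.le hl0.le) (sub_nonneg.2 hl1.le))
        (sq_nonneg (x - T x))]
    have hT'log : T' x = Z * rexp (-x ^ 2 / 2 + T x ^ 2 / 2 - f (T x)) := by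
      have hs : (√(2 * π))⁻¹ ≠ 0 := by positivity
      simp only [hT', hg, gaussianPDFReal_zero_one]
      rw [exp_sub, exp_add, neg_div, neg_div, exp_neg (T x ^ 2 / 2)]
      field_simp
    have hpow : T' x ^ l = Z ^ l * rexp (l * (-x ^ 2 / 2 + T x ^ 2 / 2 - f (T x))) := by
      rw [hT'log, mul_rpow hZpos.le (exp_pos _).le, ← exp_mul, mul_comm l]
    rw [abs_of_nonneg (by have := hT'pos x; nlinarith), smul_eq_mul]
    calc Z ^ l * g x
        ≤ Z ^ l * ((√(2 * π))⁻¹ * rexp (l * (-x ^ 2 / 2 + T x ^ 2 / 2 - f (T x))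
            + -(U x) ^ 2 / 2 + l * φ (U x))) := by
          rw [hg, gaussianPDFReal_zero_one]
          gcongr
          simp only [hU] at hφ ⊢
          nlinarith
      _ = T' x ^ l * (g (U x) * rexp (l * φ (U x))) := by
          rw [hpow, hg, gaussianPDFReal_zero_one, exp_add, exp_add]
          ring
      _ ≤ _ := by
          exact mul_le_mul_of_nonneg_right hamgm (mul_nonneg (hgpos _).le (exp_pos _).le)
  calc Z ^ l = ∫ x, Z ^ l * g x := by
        rw [integral_const_mul, integral_gaussianPDFReal_eq_one 0 one_ne_zero, mul_one]
    _ ≤ ∫ x, |(1 - l) + l * T' x| • (g (U x) * rexp (l * φ (U x))) := by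
        refine integral_mono ((integrable_gaussianPDFReal 0 1).const_mul _) ?_ key
        rw [← integrableOn_univ]
        exact (integrableOn_image_iff_integrableOn_abs_deriv_smul MeasurableSet.univ
          (fun x _ => (hUderiv x).hasDerivWithinAt) hUmono.injective.injOn
          (fun x => g x * rexp (l * φ x))).1 hφi'.integrableOn
    _ = ∫ x in U '' univ, g x * rexp (l * φ x) := by
        rw [integral_image_eq_integral_abs_deriv_smul MeasurableSet.univ
          (fun x _ => (hUderiv x).hasDerivWithinAt) hUmono.injective.injOn, setIntegral_univ]
    _ ≤ ∫ x, g x * rexp (l * φ x) :=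
        setIntegral_le_integral hφi' (ae_of_all _ fun x => mul_nonneg (hgpos x).le (exp_pos _).le)
    _ = _ := integral_gaussianReal_eq.symm

lemma log_integral_exp_gaussianReal_le {f φ : ℝ → ℝ} (hf : Continuous f)
    (hfi : Integrable (fun x => rexp (f x)) γ₁)
    (hφi : ∀ l : ℝ, Integrable (fun x => rexp (l * φ x)) γ₁)
    (h : ∀ x y, f y ≤ φ x + (x - y) ^ 2 / 2) :
    log (∫ x, rexp (f x) ∂γ₁) ≤ ∫ x, φ x ∂γ₁ := by
  have hzero : (0 : ℝ) ∈ interior (integrableExpSet φ γ₁) := by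
    rw [show integrableExpSet φ γ₁ = univ from eq_univ_of_forall hφi]
    simp
  have hderiv : HasDerivAt (cgf φ γ₁) (∫ x, φ x ∂γ₁) 0 := by
    have h1 := (analyticAt_cgf hzero).differentiableAt.hasDerivAt
    rwa [deriv_cgf_zero hzero, probReal_univ, div_one] at h1
  have hlim := hderiv.tendsto_slope_zero_right
  refine ge_of_tendsto hlim ?_
  filter_upwards [Ioo_mem_nhdsGT (zero_lt_one (α := ℝ))] with l ⟨hl0, hl1⟩
  have hle := log_le_log (rpow_pos_of_pos (integral_exp_pos hfi) l)
    (rpow_integral_exp_gaussianReal_le hf hfi hl0 hl1 (hφi l) h)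
  rw [log_rpow (integral_exp_pos hfi)] at hle
  rw [zero_add, cgf_zero, sub_zero, smul_eq_mul, ← div_eq_inv_mul, le_div_iff₀ hl0, mul_comm]
  exact hle

/-- The Gibbs variational inequality for a shifted Gaussian. -/
lemma integral_shift_gaussianReal_le {f : ℝ → ℝ} (h : ℝ)
    (hfi : Integrable (fun x => rexp (f x)) γ₁) (hfh : Integrable (fun x => f (x + h)) γ₁) :
    ∫ x, f (x + h) ∂γ₁ - h ^ 2 / 2 ≤ log (∫ x, rexp (f x) ∂γ₁) := by
  set m := ∫ x, f (x + h) ∂γ₁ - h ^ 2 / 2 with hm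
  have hpdf (x : ℝ) : gaussianPDFReal 0 1 (x + h) * rexp (f (x + h)) =
      gaussianPDFReal 0 1 x * rexp (f (x + h) - x * h - h ^ 2 / 2) := by
    rw [gaussianPDFReal_zero_one, gaussianPDFReal_zero_one, mul_assoc, mul_assoc, ← exp_add,
      ← exp_add]
    ring_nf
  have hshift : ∫ x, rexp (f x) ∂γ₁ = ∫ x, rexp (f (x + h) - x * h - h ^ 2 / 2) ∂γ₁ := by
    rw [integral_gaussianReal_eq, integral_gaussianReal_eq,
      ← integral_add_right_eq_self _ h]
    simp_rw [hpdf]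
  have hshifti : Integrable (fun x => rexp (f (x + h) - x * h - h ^ 2 / 2)) γ₁ := by
    rw [integrable_gaussianReal_iff]
    simp_rw [← hpdf]
    exact (integrable_gaussianReal_iff.1 hfi).comp_add_right h
  have hid : Integrable (fun x : ℝ => x * h) γ₁ :=
    (IsGaussian.integrable_id (μ := γ₁)).mul_const h
  have hlin : Integrable (fun x => f (x + h) - x * h - h ^ 2 / 2) γ₁ :=
    (hfh.sub hid).sub (integrable_const _)
  have hlinint : ∫ x, (f (x + h) - x * h - h ^ 2 / 2) ∂γ₁ = m := by
    rw [integral_sub (by exact hfh.sub hid) (integrable_const _), integral_sub hfh hid,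
      integral_mul_const, integral_id_gaussianReal]
    simp [hm]
  rw [le_log_iff_exp_le (integral_exp_pos hfi), hshift]
  calc rexp m = rexp m * (∫ x, (f (x + h) - x * h - h ^ 2 / 2) ∂γ₁ - m + 1) := by
        rw [hlinint]; ring
    _ = ∫ x, rexp m * ((f (x + h) - x * h - h ^ 2 / 2) - m + 1) ∂γ₁ := by
        rw [integral_const_mul,
          integral_add (by exact hlin.sub (integrable_const _)) (integrable_const _),
          integral_sub hlin (integrable_const _)]
        simp
    _ ≤ _ := by
        refine integral_mono (((hlin.sub (integrable_const _)).add (integrable_const _)).const_mul _)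
          hshifti fun x => ?_
        have := add_one_le_exp (f (x + h) - x * h - h ^ 2 / 2 - m)
        calc _ ≤ rexp m * rexp (f (x + h) - x * h - h ^ 2 / 2 - m) := by gcongr
          _ = _ := by rw [← exp_add]; ring_nf

end OneDimensional

section Lipschitz

open scoped NNReal

local notation "γ₁" => gaussianReal 0 1

instance isProbabilityMeasure_stdGaussian (n : ℕ) : IsProbabilityMeasure (stdGaussian n) := by
  unfold _root_.stdGaussian
  infer_instance

lemma integrable_of_integrable_exp {Ω : Type*} [MeasurableSpace Ω] {μ : Measure Ω} {f : Ω → ℝ}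
    (hf : AEStronglyMeasurable f μ) (hpos : Integrable (fun x => rexp (f x)) μ)
    (hneg : Integrable (fun x => rexp (-f x)) μ) : Integrable f μ := by
  refine (hpos.add hneg).mono' hf (ae_of_all _ fun x => abs_le'.2 ⟨?_, ?_⟩)
  · have := add_one_le_exp (f x)
    have := exp_pos (-f x)
    simp only [Pi.add_apply]
    linarith
  · have := add_one_le_exp (-f x)
    have := exp_pos (f x)
    simp only [Pi.add_apply]
    linarith

lemma integrable_exp_mul_abs_gaussianReal (c : ℝ) :
    Integrable (fun x : ℝ => rexp (c * |x|)) γ₁ :=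
  integrable_exp_mul_abs (integrable_exp_mul_gaussianReal c) (integrable_exp_mul_gaussianReal (-c))

variable {n : ℕ} {K : ℝ≥0}

lemma LipschitzWith.integrable_exp_gaussianReal {f : ℝ → ℝ} (hf : LipschitzWith K f) :
    Integrable (fun x => rexp (f x)) γ₁ := by
  refine ((integrable_exp_mul_abs_gaussianReal K).const_mul (rexp (f 0))).mono'
    (by have := hf.continuous; fun_prop) (ae_of_all _ fun x => ?_)
  rw [norm_of_nonneg (exp_pos _).le, ← exp_add]
  have := hf.le_add_mul x 0
  rw [dist_zero_right, norm_eq_abs] at this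
  gcongr

lemma LipschitzWith.integrable_gaussianReal {f : ℝ → ℝ} (hf : LipschitzWith K f) :
    Integrable f γ₁ :=
  integrable_of_integrable_exp hf.continuous.aestronglyMeasurable hf.integrable_exp_gaussianReal
    hf.neg.integrable_exp_gaussianReal

lemma LipschitzWith.integrable_exp_stdGaussian {f : (Fin n → ℝ) → ℝ} (hf : LipschitzWith K f) :
    Integrable (fun x => rexp (f x)) (stdGaussian n) := by
  have hprod : Integrable (fun x : Fin n → ℝ => ∏ i, rexp (K * |x i|)) (stdGaussian n) :=
    Integrable.fintype_prod fun _ => integrable_exp_mul_abs_gaussianReal K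
  refine (hprod.const_mul (rexp (f 0))).mono'
    (by have := hf.continuous; fun_prop) (ae_of_all _ fun x => ?_)
  rw [norm_of_nonneg (exp_pos _).le, ← exp_sum, ← exp_add, ← Finset.mul_sum]
  have h1 := hf.le_add_mul x 0
  rw [dist_zero_right] at h1
  have h2 : ‖x‖ ≤ ∑ i, |x i| :=
    (pi_norm_le_iff_of_nonneg (Finset.sum_nonneg fun _ _ => abs_nonneg _)).2 fun i =>
      Finset.single_le_sum (f := fun i => |x i|) (fun _ _ => abs_nonneg _) (Finset.mem_univ i)
  have h3 := mul_le_mul_of_nonneg_left h2 K.coe_nonneg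
  gcongr
  linarith

lemma LipschitzWith.integrable_stdGaussian {f : (Fin n → ℝ) → ℝ} (hf : LipschitzWith K f) :
    Integrable f (stdGaussian n) :=
  integrable_of_integrable_exp hf.continuous.aestronglyMeasurable hf.integrable_exp_stdGaussian
    hf.neg.integrable_exp_stdGaussian

lemma integral_stdGaussian_zero (g : (Fin 0 → ℝ) → ℝ) : ∫ x, g x ∂stdGaussian 0 = g 0 := by
  rw [_root_.stdGaussian, Measure.pi_of_empty _ 0, integral_dirac]

lemma integral_stdGaussian_succ {g : (Fin (n + 1) → ℝ) → ℝ}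
    (hg : Integrable g (stdGaussian (n + 1))) :
    ∫ x, g x ∂stdGaussian (n + 1) =
      ∫ y, ∫ t, g (Fin.cons t y) ∂γ₁ ∂stdGaussian n := by
  have hmp := (measurePreserving_piFinSuccAbove (fun _ : Fin (n + 1) => γ₁) 0).symm
  have hg' := (hmp.integrable_comp_emb (MeasurableEquiv.measurableEmbedding _)).2 hg
  change _ = ∫ y, ∫ t, g (Fin.cons t y) ∂γ₁ ∂(Measure.pi fun _ : Fin n => γ₁)
  rw [_root_.stdGaussian, ← hmp.integral_comp', integral_prod_symm _ (by exact hg')]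
  simp [MeasurableEquiv.piFinSuccAbove, Fin.insertNthEquiv, Fin.insertNth_zero']

lemma dist_fin_cons (s t : ℝ) (x y : Fin n → ℝ) :
    dist (Fin.cons s x : Fin (n + 1) → ℝ) (Fin.cons t y) = max (dist s t) (dist x y) := by
  refine le_antisymm ?_ (max_le ?_ ?_)
  · refine (dist_pi_le_iff (le_max_of_le_left dist_nonneg)).2 (Fin.cases ?_ fun i => ?_)
    · simp
    · simpa using .inr (dist_le_pi_dist x y i)
  · simpa using dist_le_pi_dist (Fin.cons s x : Fin (n + 1) → ℝ) (Fin.cons t y) 0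
  · refine (dist_pi_le_iff dist_nonneg).2 fun i => ?_
    simpa using dist_le_pi_dist (Fin.cons s x : Fin (n + 1) → ℝ) (Fin.cons t y) i.succ

section Cons

variable {f : (Fin (n + 1) → ℝ) → ℝ}

lemma LipschitzWith.comp_fin_cons_left (hf : LipschitzWith K f) (y : Fin n → ℝ) :
    LipschitzWith K (fun t => f (Fin.cons t y)) :=
  LipschitzWith.of_dist_le_mul fun s t => by
    simpa [dist_fin_cons] using hf.dist_le_mul (Fin.cons s y) (Fin.cons t y)

lemma LipschitzWith.comp_fin_cons_le (hf : LipschitzWith K f) (t : ℝ) (x y : Fin n → ℝ) :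
    f (Fin.cons t x) ≤ f (Fin.cons t y) + K * dist x y := by
  simpa [dist_fin_cons] using hf.le_add_mul (Fin.cons t x) (Fin.cons t y)

lemma LipschitzWith.integral_fin_cons (hf : LipschitzWith K f) :
    LipschitzWith K (fun y : Fin n → ℝ => ∫ t, f (Fin.cons t y) ∂γ₁) := by
  refine LipschitzWith.of_le_add_mul K fun x y => ?_
  have hi (z : Fin n → ℝ) := (hf.comp_fin_cons_left z).integrable_gaussianReal
  calc ∫ t, f (Fin.cons t x) ∂γ₁
      ≤ ∫ t, (f (Fin.cons t y) + K * dist x y) ∂γ₁ :=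
        integral_mono (hi x) ((hi y).add (integrable_const _)) fun t => hf.comp_fin_cons_le t x y
    _ = _ := by rw [integral_add (hi y) (integrable_const _)]; simp

lemma LipschitzWith.log_integral_exp_fin_cons (hf : LipschitzWith K f) :
    LipschitzWith K (fun y : Fin n → ℝ => log (∫ t, rexp (f (Fin.cons t y)) ∂γ₁)) := by
  refine LipschitzWith.of_le_add_mul K fun x y => ?_
  have hi (z : Fin n → ℝ) := (hf.comp_fin_cons_left z).integrable_exp_gaussianReal
  rw [← log_exp (K * dist x y), ← log_mul (integral_exp_pos (hi y)).ne' (exp_pos _).ne',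
    ← integral_mul_const]
  refine log_le_log (integral_exp_pos (hi x)) (integral_mono (hi x) ((hi y).mul_const _) fun t => ?_)
  simp only [← exp_add]
  exact exp_le_exp.2 (hf.comp_fin_cons_le t x y)

lemma LipschitzWith.integral_exp_stdGaussian_succ (hf : LipschitzWith K f) :
    ∫ x, rexp (f x) ∂stdGaussian (n + 1) =
      ∫ y, rexp (log (∫ t, rexp (f (Fin.cons t y)) ∂γ₁)) ∂stdGaussian n := by
  rw [integral_stdGaussian_succ hf.integrable_exp_stdGaussian]
  congr with y
  rw [exp_log (integral_exp_pos (hf.comp_fin_cons_left y).integrable_exp_gaussianReal)]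

end Cons

/-- The dual form of Talagrand's transport inequality for the standard Gaussian measure. -/
lemma log_integral_exp_stdGaussian_le {f φ : (Fin n → ℝ) → ℝ} {L : ℝ≥0}
    (hf : LipschitzWith K f) (hφ : LipschitzWith L φ)
    (h : ∀ x y, f y ≤ φ x + (∑ i, (x i - y i) ^ 2) / 2) :
    log (∫ x, rexp (f x) ∂stdGaussian n) ≤ ∫ x, φ x ∂stdGaussian n := by
  induction n with
  | zero => simpa [integral_stdGaussian_zero] using h 0 0
  | succ n ih =>
    rw [hf.integral_exp_stdGaussian_succ, integral_stdGaussian_succ hφ.integrable_stdGaussian]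
    refine ih hf.log_integral_exp_fin_cons hφ.integral_fin_cons fun x y => ?_
    have hφx := hφ.comp_fin_cons_left x
    set c := (∑ i, (x i - y i) ^ 2) / 2 with hc
    have hφc : LipschitzWith L (fun t => φ (Fin.cons t x) + c) := by
      simpa using hφx.add (LipschitzWith.const c)
    have := log_integral_exp_gaussianReal_le (hf.comp_fin_cons_left y).continuous
      (hf.comp_fin_cons_left y).integrable_exp_gaussianReal
      (φ := fun t => φ (Fin.cons t x) + c)
      (fun l => ((lipschitzWith_smul l).comp hφc).integrable_exp_gaussianReal) fun s t => by
        have := h (Fin.cons s x) (Fin.cons t y)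
        simp only [Fin.sum_univ_succ, Fin.cons_zero, Fin.cons_succ] at this
        rw [hc]
        linarith
    rwa [integral_add hφx.integrable_gaussianReal (integrable_const _), integral_const,
      probReal_univ, one_smul] at this

lemma LipschitzWith.comp_add_right {E : Type*} [SeminormedAddCommGroup E] {f : E → ℝ}
    (hf : LipschitzWith K f) (h : E) : LipschitzWith K (fun x => f (x + h)) := by
  refine LipschitzWith.of_dist_le_mul fun x y => ?_
  simpa using hf.dist_le_mul (x + h) (y + h)

/-- The Gibbs variational inequality for a shifted standard Gaussian measure. -/
lemma integral_shift_stdGaussian_le {f : (Fin n → ℝ) → ℝ} (hf : LipschitzWith K f)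
    (h : Fin n → ℝ) :
    ∫ x, f (x + h) ∂stdGaussian n - (∑ i, h i ^ 2) / 2 ≤
      log (∫ x, rexp (f x) ∂stdGaussian n) := by
  induction n with
  | zero => simp [integral_stdGaussian_zero, Subsingleton.elim h 0]
  | succ n ih =>
    have hfh := hf.comp_add_right h
    rw [hf.integral_exp_stdGaussian_succ, integral_stdGaussian_succ hfh.integrable_stdGaussian,
      Fin.sum_univ_succ]
    have hF := hf.log_integral_exp_fin_cons
    refine le_trans ?_ (ih hF (Fin.tail h))
    have hcons (t : ℝ) (y : Fin n → ℝ) : (Fin.cons t y + h : Fin (n + 1) → ℝ) =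
        Fin.cons (t + h 0) (y + Fin.tail h) := by
      ext i
      refine Fin.cases ?_ (fun i => ?_) i <;> simp [Fin.tail]
    have hle : ∫ y, ∫ t, f (Fin.cons t y + h) ∂γ₁ ∂stdGaussian n ≤
        ∫ y, (log (∫ t, rexp (f (Fin.cons t (y + Fin.tail h))) ∂γ₁) + h 0 ^ 2 / 2)
          ∂stdGaussian n := by
      refine integral_mono hfh.integral_fin_cons.integrable_stdGaussian
        ((hF.comp_add_right (Fin.tail h)).integrable_stdGaussian.add (integrable_const _))
        fun y => ?_
      have hfy := hf.comp_fin_cons_left (y + Fin.tail h)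
      have := integral_shift_gaussianReal_le (h 0) hfy.integrable_exp_gaussianReal
        (hfy.comp_add_right (h 0)).integrable_gaussianReal
      simp only [hcons]
      linarith
    rw [integral_add (hF.comp_add_right (Fin.tail h)).integrable_stdGaussian
      (integrable_const _)] at hle
    simp only [integral_const, probReal_univ, one_smul] at hle
    simp only [Fin.tail] at hle ⊢
    linarith

end Lipschitz

section Symmetrization

local notation "γ₁" => gaussianReal 0 1

lemma map_sub_gaussianReal_prod :
    (Measure.prod γ₁ γ₁).map (fun p => p.1 - p.2) = (γ₁).map (fun x => √2 * x) := by
  have hneg : (γ₁).map (fun x : ℝ => -x) = γ₁ := by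
    simpa using gaussianReal_map_neg (μ := 0) (v := 1)
  have hconv : γ₁ ∗ γ₁ = (Measure.prod γ₁ γ₁).map (fun p => p.1 - p.2) := by
    calc γ₁ ∗ γ₁ = (γ₁).map id ∗ (γ₁).map (fun x : ℝ => -x) := by rw [hneg, Measure.map_id]
      _ = _ := by
        rw [Measure.conv, Measure.map_prod_map _ _ measurable_id measurable_neg,
          Measure.map_map (by fun_prop) (by fun_prop)]
        simp [Function.comp_def, sub_eq_add_neg]
  rw [← hconv, gaussianReal_conv_gaussianReal, gaussianReal_map_const_mul]
  congr 1
  · simp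
  · ext; norm_num

lemma map_sub_stdGaussian_prod (n : ℕ) :
    ((stdGaussian n).prod (stdGaussian n)).map (fun p => p.1 - p.2) =
      (stdGaussian n).map (fun x => √2 • x) := by
  have hpair := (measurePreserving_arrowProdEquivProdArrow ℝ ℝ (Fin n) (fun _ => γ₁)
    (fun _ => γ₁)).map_eq
  have hsub : Measurable (fun p : ℝ × ℝ => p.1 - p.2) := by fun_prop
  have hmul : Measurable (fun x : ℝ => √2 * x) := by fun_prop
  have := fun _ : Fin n =>
    Measure.isProbabilityMeasure_map (μ := Measure.prod γ₁ γ₁) hsub.aemeasurable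
  have := fun _ : Fin n => Measure.isProbabilityMeasure_map (μ := γ₁) hmul.aemeasurable
  have h1 := Measure.pi_map_pi (μ := fun _ : Fin n => Measure.prod γ₁ γ₁)
    (f := fun _ p => p.1 - p.2) (fun _ => hsub.aemeasurable)
  have h2 := Measure.pi_map_pi (μ := fun _ : Fin n => γ₁)
    (f := fun _ x => √2 * x) (fun _ => hmul.aemeasurable)
  simp only [map_sub_gaussianReal_prod] at h1
  rw [_root_.stdGaussian, ← hpair, Measure.map_map (by fun_prop) (MeasurableEquiv.measurable _)]
  exact h1.trans h2.symm

end Symmetrization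

section MeanWidth

variable {n : ℕ} {f : (Fin n → ℝ) → ℝ}

local notation "σ" => fun x : Fin n → ℝ => ⨆ y : Fin n → ℝ, ∑ i, gradVec n f y i * x i

lemma sum_gradVec_mul (y v : Fin n → ℝ) : ∑ i, gradVec n f y i * v i = fderiv ℝ f y v := by
  conv_rhs => rw [pi_eq_sum_univ' v, map_sum]
  simp [gradVec, mul_comm, Pi.single]

lemma sub_le_iSup_gradVec (hf : ContDiff ℝ 1 f)
    (hbdd : ∀ x : Fin n → ℝ,
      BddAbove (range fun y : Fin n → ℝ => ∑ i, gradVec n f y i * x i)) (a b : Fin n → ℝ) :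
    f a - f b ≤ σ (a - b) := by
  obtain ⟨z, -, hz⟩ := domain_mvt (f := f) (s := univ) (x := b) (y := a)
    (fun x _ => (hf.differentiable one_ne_zero x).hasFDerivAt.hasFDerivWithinAt)
    convex_univ (mem_univ _) (mem_univ _)
  rw [hz, ← sum_gradVec_mul]
  exact le_ciSup (hbdd (a - b)) z

lemma iSup_gradVec_le_add (hbdd : ∀ x : Fin n → ℝ,
      BddAbove (range fun y : Fin n → ℝ => ∑ i, gradVec n f y i * x i)) (a b : Fin n → ℝ) :
    σ a ≤ σ b + σ (a - b) := by
  refine ciSup_le fun y => ?_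
  have h1 := le_ciSup (hbdd b) y
  have h2 := le_ciSup (hbdd (a - b)) y
  simp only [Pi.sub_apply, mul_sub, Finset.sum_sub_distrib] at h1 h2 ⊢
  linarith

lemma exists_iSup_gradVec_le_mul_norm (hbdd : ∀ x : Fin n → ℝ,
      BddAbove (range fun y : Fin n → ℝ => ∑ i, gradVec n f y i * x i)) :
    ∃ C : NNReal, ∀ x, σ x ≤ C * ‖x‖ := by
  have hcoord (i : Fin n) : ∃ c : ℝ, ∀ y, |gradVec n f y i| ≤ c := by
    obtain ⟨a, ha⟩ := hbdd (Pi.single i 1)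
    obtain ⟨b, hb⟩ := hbdd (Pi.single i (-1))
    refine ⟨max a b, fun y => abs_le'.2 ⟨le_max_of_le_left ?_, le_max_of_le_right ?_⟩⟩
    · simpa [Pi.single_apply] using ha (mem_range_self y)
    · simpa [Pi.single_apply] using hb (mem_range_self y)
  choose c hc using hcoord
  have hc0 (i : Fin n) : 0 ≤ c i := (abs_nonneg _).trans (hc i 0)
  refine ⟨.mk (∑ i, c i) (Finset.sum_nonneg fun i _ => hc0 i), fun x => ciSup_le fun y => ?_⟩
  rw [NNReal.coe_mk, Finset.sum_mul]
  refine Finset.sum_le_sum fun i _ => (le_abs_self _).trans ?_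
  rw [abs_mul]
  exact mul_le_mul (hc i y) (norm_le_pi_norm x i) (abs_nonneg _) (hc0 i)

lemma iSup_gradVec_smul {c : ℝ} (hc : 0 ≤ c) (x : Fin n → ℝ) : σ (c • x) = c * σ x := by
  simp only [Pi.smul_apply, smul_eq_mul, Real.mul_iSup_of_nonneg hc, Finset.mul_sum]
  congr with y
  exact Finset.sum_congr rfl fun i _ => by ring

end MeanWidth

lemma LipschitzWith.comp_sub_left {E : Type*} [SeminormedAddCommGroup E] {K : NNReal} {s : E → ℝ}
    (hs : LipschitzWith K s) (z : E) : LipschitzWith K (fun x => s (z - x)) :=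
  LipschitzWith.of_dist_le_mul fun x y => by
    simpa only [dist_sub_left] using hs.dist_le_mul (z - x) (z - y)

lemma LipschitzWith.integral_comp_sub_stdGaussian {n : ℕ} {K : NNReal} {s : (Fin n → ℝ) → ℝ}
    (hs : LipschitzWith K s) :
    LipschitzWith K (fun x => ∫ x', s (x - x') ∂stdGaussian n) := by
  have hi (z : Fin n → ℝ) : Integrable (fun x' => s (z - x')) (stdGaussian n) :=
    (hs.comp_sub_left z).integrable_stdGaussian
  refine LipschitzWith.of_le_add_mul K fun x y => ?_
  calc ∫ x', s (x - x') ∂stdGaussian n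
      ≤ ∫ x', (s (y - x') + K * dist x y) ∂stdGaussian n :=
        integral_mono (hi x) ((hi y).add (integrable_const _)) fun x' => by
          simpa using hs.le_add_mul (x - x') (y - x')
    _ = _ := by rw [integral_add (hi y) (integrable_const _)]; simp

lemma LipschitzWith.integral_integral_sub_stdGaussian {n : ℕ} {K : NNReal} {s : (Fin n → ℝ) → ℝ}
    (hs : LipschitzWith K s) :
    ∫ x, ∫ x', s (x - x') ∂stdGaussian n ∂stdGaussian n = ∫ x, s (√2 • x) ∂stdGaussian n := by
  have hsc := hs.continuous
  have hi : Integrable (fun p : (Fin n → ℝ) × (Fin n → ℝ) => s (p.1 - p.2))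
      ((stdGaussian n).prod (stdGaussian n)) := by
    have h1 : Integrable s ((stdGaussian n).map fun x => √2 • x) := by
      rw [integrable_map_measure hsc.aestronglyMeasurable (by fun_prop)]
      exact (hs.comp (lipschitzWith_smul (√2))).integrable_stdGaussian
    rw [← map_sub_stdGaussian_prod] at h1
    exact (integrable_map_measure hsc.aestronglyMeasurable (by fun_prop)).1 h1
  rw [← integral_prod _ hi,
    ← integral_map (φ := fun p : (Fin n → ℝ) × (Fin n → ℝ) => p.1 - p.2) (by fun_prop)
      hsc.aestronglyMeasurable,
    map_sub_stdGaussian_prod, integral_map (by fun_prop) hsc.aestronglyMeasurable]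

/-- **Gaussian mean-field approximation.** For `f : ℝⁿ → ℝ` continuously differentiable
with `e^f` Gaussian-integrable, `f(· + h)` Gaussian-integrable for each `h`, and finite
Gaussian mean-width `g(V)` of `V = ∇f(ℝⁿ)`:
`sup_h (∫ f(x+h) dγ - ‖h‖²/2) ≤ log ∫ e^f dγ ≤ sup_h (∫ f(x+h) dγ - ‖h‖²/2) + √2 g(V)`. -/
theorem gaussian_meanField (n : ℕ) (f : (Fin n → ℝ) → ℝ) (hf : ContDiff ℝ 1 f)
    (hexp : Integrable (fun x => Real.exp (f x)) (stdGaussian n))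
    (hshift : ∀ h : Fin n → ℝ, Integrable (fun x => f (x + h)) (stdGaussian n))
    (hbdd : ∀ x : Fin n → ℝ,
      BddAbove (Set.range fun y : Fin n → ℝ => ∑ i, gradVec n f y i * x i))
    (hgfin : Integrable
      (fun x => ⨆ y : Fin n → ℝ, ∑ i, gradVec n f y i * x i) (stdGaussian n)) :
    (⨆ h : Fin n → ℝ, (∫ x, f (x + h) ∂stdGaussian n - (∑ i, (h i) ^ 2) / 2)) ≤
        Real.log (∫ x, Real.exp (f x) ∂stdGaussian n) ∧
      Real.log (∫ x, Real.exp (f x) ∂stdGaussian n) ≤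
        (⨆ h : Fin n → ℝ, (∫ x, f (x + h) ∂stdGaussian n - (∑ i, (h i) ^ 2) / 2)) +
          Real.sqrt 2 *
            ∫ x, (⨆ y : Fin n → ℝ, ∑ i, gradVec n f y i * x i) ∂stdGaussian n := by
  obtain ⟨C, hC⟩ := exists_iSup_gradVec_le_mul_norm hbdd
  set σ : (Fin n → ℝ) → ℝ := fun x => ⨆ y : Fin n → ℝ, ∑ i, gradVec n f y i * x i
  have hfσ (a b : Fin n → ℝ) : f a - f b ≤ σ (a - b) := sub_le_iSup_gradVec hf hbdd a b
  have hfL : LipschitzWith C f := LipschitzWith.of_le_add_mul C fun a b => by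
    rw [dist_eq_norm]
    linarith [hfσ a b, hC (a - b)]
  have hσL : LipschitzWith C σ := LipschitzWith.of_le_add_mul C fun a b => by
    rw [dist_eq_norm]
    exact (iSup_gradVec_le_add hbdd a b).trans (add_le_add_right (hC (a - b)) _)
  have hlower := integral_shift_stdGaussian_le hfL
  refine ⟨ciSup_le hlower, ?_⟩
  set M := ⨆ h : Fin n → ℝ, (∫ x, f (x + h) ∂stdGaussian n - (∑ i, (h i) ^ 2) / 2)
  have hM (h : Fin n → ℝ) : ∫ x, f (x + h) ∂stdGaussian n - (∑ i, (h i) ^ 2) / 2 ≤ M :=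
    le_ciSup ⟨_, forall_mem_range.2 hlower⟩ h
  have hφL := hσL.integral_comp_sub_stdGaussian
  have hφML : LipschitzWith C (fun x => ∫ x', σ (x - x') ∂stdGaussian n + M) := by
    simpa using hφL.add (LipschitzWith.const M)
  have hupper := log_integral_exp_stdGaussian_le hfL hφML fun x y => by
    have hσi : Integrable (fun x' => σ (x - x')) (stdGaussian n) :=
      (hσL.comp_sub_left x).integrable_stdGaussian
    have hle : f y ≤ ∫ x', (f (x' + (y - x)) + σ (x - x')) ∂stdGaussian n := by
      calc f y = ∫ _, f y ∂stdGaussian n := by simp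
        _ ≤ _ := integral_mono (integrable_const _) ((hshift _).add hσi) fun x' => by
          have h1 := hfσ y (x' + (y - x))
          rw [show y - (x' + (y - x)) = x - x' by abel] at h1
          simp only [Pi.add_apply]
          linarith
    rw [integral_add (hshift _) hσi] at hle
    have h2 := hM (y - x)
    have h3 : ∑ i, (y - x) i ^ 2 = ∑ i, (x i - y i) ^ 2 :=
      Finset.sum_congr rfl fun i _ => by rw [Pi.sub_apply]; ring
    rw [h3] at h2
    linarith
  rw [integral_add hφL.integrable_stdGaussian (integrable_const _),
    hσL.integral_integral_sub_stdGaussian] at hupper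
  have hσ2 (x : Fin n → ℝ) : σ (√2 • x) = √2 * σ x := iSup_gradVec_smul (sqrt_nonneg 2) x
  simp only [hσ2, integral_const_mul, integral_const, probReal_univ, one_smul] at hupper
  linarith
end
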